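/- arXiv:1905.12825 — 8 statements merged into one kernel-verified Lean document; each statement's English description precedes it below -/
import Mathlib

section
/- Let d ≥ 1, let U ⊆ ℝ^d be an open neighborhood of a point x₀, and let f : U → ℝ be coordinatewise nondecreasing on U. Fix k ∈ {1,…,d} and an integer m ≥ 1, suppose f is m times continuously differentiable on U, that the pure partial derivatives satisfy ∂_k^j f(x₀) = 0 for all 1 ≤ j ≤ m − 1, and that ∂_k^m f(x₀) ≠ 0. Then m is odd and ∂_k^m f(x₀) > 0. -/
/-- Iterated partial derivative in the `k`-th coordinate (one step). -/
noncomputable def pderiv (d : ℕ) (k : Fin d) (f : (Fin d → ℝ) → ℝ) : (Fin d → ℝ) → ℝ :=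
  fun x => fderiv ℝ f x (Pi.single k 1)

/-- `j`-fold iterated partial derivative in the `k`-th coordinate. -/
noncomputable def pderivIter (d : ℕ) (k : Fin d) (j : ℕ) (f : (Fin d → ℝ) → ℝ) :
    (Fin d → ℝ) → ℝ :=
  (pderiv d k)^[j] f

theorem aux_sign (n : ℕ) : ∀ (G : ℕ → ℝ → ℝ) (r : ℝ),
    (∀ j < n, ∀ t ∈ Set.Ioo (-r) r, HasDerivAt (G j) (G (j+1) t) t) →
    (∀ j < n, G j 0 = 0) → (∀ t ∈ Set.Ioo (-r) r, 0 < G n t) →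
    (∀ t ∈ Set.Ioo 0 r, 0 < G 0 t) ∧ (∀ t ∈ Set.Ioo (-r) 0, 0 < (-1)^n * G 0 t) := by
  induction n with
  | zero =>
    intro G r _ _ h
    refine ⟨fun t ht => h t ⟨by linarith [ht.1, ht.2], ht.2⟩, fun t ht => ?_⟩
    have := h t ⟨ht.1, by linarith [ht.1, ht.2]⟩
    simpa using this
  | succ n ih =>
    intro G r hd h0 hp
    obtain ⟨h1, h2⟩ := ih (fun j => G (j+1)) r (fun j hj => hd (j+1) (by omega))
      (fun j hj => h0 (j+1) (by omega)) hp
    have h00 := h0 0 (by omega)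
    constructor
    · intro t ht
      obtain ⟨c, hc, he⟩ := exists_hasDerivAt_eq_slope (G 0) (G 1) ht.1
        (fun x hx => (hd 0 (by omega) x ⟨by linarith [hx.1, ht.1, ht.2], by linarith [hx.2, ht.2]⟩).continuousAt.continuousWithinAt)
        (fun x hx => hd 0 (by omega) x ⟨by linarith [hx.1, ht.1, ht.2], by linarith [hx.2, ht.2]⟩)
      have hpos := h1 c ⟨hc.1, by linarith [hc.2, ht.2]⟩
      have ht0 : 0 < t := ht.1
      rw [h00, sub_zero, sub_zero, eq_div_iff ht0.ne'] at he
      rw [← he]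
      exact mul_pos hpos ht0
    · intro t ht
      obtain ⟨c, hc, he⟩ := exists_hasDerivAt_eq_slope (G 0) (G 1) ht.2
        (fun x hx => (hd 0 (by omega) x ⟨by linarith [hx.1, ht.1, ht.2], by linarith [hx.2, ht.1, ht.2]⟩).continuousAt.continuousWithinAt)
        (fun x hx => hd 0 (by omega) x ⟨by linarith [hx.1, ht.1, ht.2], by linarith [hx.2, ht.1, ht.2]⟩)
      have hpos := h2 c ⟨by linarith [hc.1, ht.1], hc.2⟩
      have ht0 : t < 0 := ht.2
      rw [h00, zero_sub, zero_sub, eq_div_iff (by linarith)] at he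
      have : G 0 t = G 1 c * t := by linarith
      rw [this, pow_succ]
      have h3 := mul_pos hpos (neg_pos.2 ht0)
      simp only [zero_add] at h3
      nlinarith

theorem aux_smooth (d : ℕ) (U : Set (Fin d → ℝ)) (hU : IsOpen U) (f : (Fin d → ℝ) → ℝ)
    (k : Fin d) (m : ℕ) (hsmooth : ContDiffOn ℝ m f U) (j : ℕ) :
    ∀ i, i + j = m → ContDiffOn ℝ i (pderivIter d k j f) U := by
  induction j with
  | zero => intro i hi; simpa [pderivIter, ← hi] using hsmooth
  | succ j ih =>
    intro i hi
    have h := ih (i+1) (by omega)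
    have h2 : ContDiffOn ℝ i (fderiv ℝ (pderivIter d k j f)) U :=
      h.fderiv_of_isOpen hU (by norm_cast)
    have h3 := h2.clm_apply (contDiffOn_const (c := (Pi.single k 1 : Fin d → ℝ)))
    simp only [pderivIter, Function.iterate_succ_apply'] at h3 ⊢
    exact h3

/-- If a coordinatewise nondecreasing function `f` is `C^m` near `x₀`, its pure partial
derivatives in coordinate `k` of orders `1,…,m-1` vanish at `x₀` while the order-`m` one
does not, then `m` is odd and `∂_k^m f(x₀) > 0`. -/
theorem stmt0 (d : ℕ) (hd : 1 ≤ d) (U : Set (Fin d → ℝ)) (hU : IsOpen U)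
    (x₀ : Fin d → ℝ) (hx₀ : x₀ ∈ U) (f : (Fin d → ℝ) → ℝ)
    (hmono : MonotoneOn f U) (k : Fin d) (m : ℕ) (hm : 1 ≤ m)
    (hsmooth : ContDiffOn ℝ m f U)
    (hvanish : ∀ j : ℕ, 1 ≤ j → j ≤ m - 1 → pderivIter d k j f x₀ = 0)
    (hnonzero : pderivIter d k m f x₀ ≠ 0) :
    Odd m ∧ 0 < pderivIter d k m f x₀ := by
  set e : Fin d → ℝ := Pi.single k 1 with he
  have he0 : 0 ≤ e := by rw [he]; exact Pi.single_nonneg.2 zero_le_one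
  set L : ℝ → (Fin d → ℝ) := fun t => x₀ + t • e with hL
  have hLc : Continuous L := by fun_prop
  have hL0 : L 0 = x₀ := by simp [hL]
  have hLd : ∀ t, HasDerivAt L e t := fun t => by
    have h := ((hasDerivAt_id t).smul_const e).const_add x₀
    rw [one_smul] at h
    exact h
  have hUn : ∀ᶠ t in nhds (0:ℝ), L t ∈ U :=
    hLc.continuousAt.eventually_mem (by rw [hL0]; exact hU.mem_nhds hx₀)
  have hder : ∀ j < m, ∀ t, L t ∈ U →
      HasDerivAt (fun t => pderivIter d k j f (L t)) (pderivIter d k (j+1) f (L t)) t := by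
    intro j hj t ht
    have h := aux_smooth d U hU f k m hsmooth j (m - j) (by omega)
    have h2 : DifferentiableAt ℝ (pderivIter d k j f) (L t) :=
      (h.contDiffAt (hU.mem_nhds ht)).differentiableAt (by norm_cast; omega)
    have h3 := h2.hasFDerivAt.comp_hasDerivAt t (hLd t)
    simp only [pderivIter, Function.iterate_succ_apply'] at h3 ⊢
    exact h3
  have hcont : ContinuousAt (fun t => pderivIter d k m f (L t)) 0 := by
    have h := aux_smooth d U hU f k m hsmooth m 0 (by omega)
    have h2 : ContinuousAt (pderivIter d k m f) (L 0) :=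
      h.continuousOn.continuousAt (by rw [hL0]; exact hU.mem_nhds hx₀)
    exact h2.comp hLc.continuousAt
  -- main consequence
  have key : ∀ s : ℝ, 0 < s * pderivIter d k m f x₀ → ∃ r > 0, 
      0 ≤ f (L r) - f x₀ ∧ f (L (-r)) - f x₀ ≤ 0 ∧
      0 < s * (f (L r) - f x₀) ∧ 0 < (-1)^m * (s * (f (L (-r)) - f x₀)) := by
    intro s hs
    have hpos : ∀ᶠ t in nhds (0:ℝ), 0 < s * pderivIter d k m f (L t) :=
      (continuousAt_const.mul hcont).eventually_const_lt (by simpa [hL0] using hs)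
    obtain ⟨r, hr, hball⟩ := Metric.eventually_nhds_iff_ball.1 (hUn.and hpos)
    rw [Real.ball_eq_Ioo, zero_sub, zero_add] at hball
    obtain ⟨h1, h2⟩ := aux_sign m
      (fun j t => s * (pderivIter d k j f (L t) - if j = 0 then f x₀ else 0)) r
      (fun j hj t ht => by
        simpa using ((hder j hj t (hball t ht).1).sub_const (if j = 0 then f x₀ else 0)).const_mul s)
      (fun j hj => by
        rcases Nat.eq_zero_or_pos j with rfl | hj0
        · simp [hL0, pderivIter]
        · simp [hL0, hvanish j hj0 (by omega), hj0.ne'])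
      (fun t ht => by
        have : m ≠ 0 := by omega
        simpa [this] using (hball t ht).2)
    have a1 := h1 (r/2) ⟨by linarith, by linarith⟩
    have a2 := h2 (-(r/2)) ⟨by linarith, by linarith⟩
    refine ⟨r/2, by linarith, ?_, ?_, by simpa [pderivIter] using a1, by simpa [pderivIter] using a2⟩
    · refine sub_nonneg.2 (hmono hx₀ (hball _ ⟨by linarith, by linarith⟩).1 ?_)
      exact le_add_of_nonneg_right (smul_nonneg (by linarith) he0)
    · refine sub_nonpos.2 (hmono (hball _ ⟨by linarith, by linarith⟩).1 hx₀ ?_)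
      exact add_le_of_nonpos_right (smul_nonpos_of_nonpos_of_nonneg (by linarith) he0)
  have hp : 0 < pderivIter d k m f x₀ := by
    by_contra hn
    have hlt := lt_of_le_of_ne (not_lt.1 hn) hnonzero
    obtain ⟨r, hr, h1, h2, h3, h4⟩ := key (-1) (by linarith)
    linarith
  refine ⟨?_, hp⟩
  obtain ⟨r, hr, h1, h2, h3, h4⟩ := key 1 (by linarith)
  by_contra ho
  rw [(Nat.not_odd_iff_even.1 ho).neg_one_pow] at h4
  linarith
end

section
/- Let d ≥ 1, let U ⊆ ℝ^d be an open neighborhood of a point x₀, and let f : U → ℝ be infinitely differentiable on U and coordinatewise nondecreasing on U. Let α_1,…,α_d be positive integers such that ∂_k^j f(x₀) = 0 for all 1 ≤ j ≤ α_k − 1 and all 1 ≤ k ≤ d. Then for every multi-index 𝐣 = (j_1,…,j_d) ∈ ℤ_{≥0}^d with 0 < Σ_{k=1}^d j_k/α_k < 1, the mixed partial derivative ∂^𝐣 f(x₀) = ∂_1^{j_1}⋯∂_d^{j_d} f(x₀) vanishes. -/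
/-- Mixed partial derivative `∂^𝐣 = ∂_1^{j_1} ⋯ ∂_d^{j_d}`. -/
noncomputable def mixedPDeriv (d : ℕ) (j : Fin d → ℕ) (f : (Fin d → ℝ) → ℝ) :
    (Fin d → ℝ) → ℝ :=
  (List.finRange d).foldr (fun k g => pderivIter d k (j k) g) f

open Filter Topology in
lemma aux_uni (N : ℕ) : ∀ q : Polynomial ℝ,
    (fun t : ℝ => q.eval t) =O[𝓝[>] 0] (fun t => t ^ N) → ∀ m < N, q.coeff m = 0 := by
  induction N with
  | zero => intro q _ m hm; omega
  | succ N ih =>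
    intro q hq
    have h1 : (fun t : ℝ => q.eval t) =O[𝓝[>] 0] (fun t => t ^ N) := by
      refine hq.trans ?_
      have : (fun t : ℝ => t ^ (N+1)) =O[𝓝 0] (fun t => t ^ N) :=
        Asymptotics.IsBigO.of_bound 1 (by
          filter_upwards [Metric.closedBall_mem_nhds (0:ℝ) one_pos] with t ht
          have ht' : |t| ≤ 1 := by simpa using ht
          rw [pow_succ, norm_mul, one_mul]
          exact mul_le_of_le_one_right (norm_nonneg _) ht')
      exact this.mono nhdsWithin_le_nhds
    have h2 := ih q h1
    obtain ⟨r, rfl⟩ := Polynomial.X_pow_dvd_iff.2 h2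
    have h3 : (fun t : ℝ => r.eval t) =O[𝓝[>] 0] (fun t => t) := by
      have h4 : (fun t : ℝ => (t^N)⁻¹) =O[𝓝[>] 0] (fun t => (t^N)⁻¹) := Asymptotics.isBigO_refl _ _
      refine (h4.mul hq).congr' ?_ ?_
      · filter_upwards [self_mem_nhdsWithin] with t ht
        have : t ≠ 0 := ne_of_gt ht
        simp; field_simp
      · filter_upwards [self_mem_nhdsWithin] with t ht
        have : t ≠ 0 := ne_of_gt ht
        rw [pow_succ]; field_simp
    have h5 : Tendsto (fun t : ℝ => r.eval t) (𝓝[>] 0) (𝓝 0) :=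
      h3.trans_tendsto (tendsto_id.mono_left nhdsWithin_le_nhds)
    have h6 : Tendsto (fun t : ℝ => r.eval t) (𝓝[>] 0) (𝓝 (r.eval 0)) :=
      (r.continuous.tendsto 0).mono_left nhdsWithin_le_nhds
    have h7 : r.coeff 0 = 0 := by
      rw [Polynomial.coeff_zero_eq_eval_zero]; exact tendsto_nhds_unique h6 h5
    intro m hm
    rcases Nat.lt_succ_iff_lt_or_eq.1 hm with h | rfl
    · exact h2 m h
    · rw [Polynomial.coeff_X_pow_mul']; simpa using h7

lemma pd_smooth {d : ℕ} (k : Fin d) {f : (Fin d → ℝ) → ℝ} (hf : ContDiff ℝ (⊤ : ℕ∞) f) :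
    ContDiff ℝ (⊤ : ℕ∞) (pderiv d k f) :=
  (hf.fderiv_right (m := ((⊤ : ℕ∞) : WithTop ℕ∞)) (by simp)).clm_apply contDiff_const

lemma pd_comm {d : ℕ} (k l : Fin d) {f : (Fin d → ℝ) → ℝ} (hf : ContDiff ℝ (⊤ : ℕ∞) f) :
    pderiv d k (pderiv d l f) = pderiv d l (pderiv d k f) := by
  funext x
  have hd : Differentiable ℝ (fderiv ℝ f) :=
    (hf.fderiv_right (m := ((⊤ : ℕ∞) : WithTop ℕ∞)) (by simp)).differentiable (by simp)
  have hs : IsSymmSndFDerivAt ℝ f x := hf.contDiffAt.isSymmSndFDerivAt (by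
    rw [minSmoothness_of_isRCLikeNormedField]
    exact WithTop.coe_le_coe.2 (le_top : (2:ℕ∞) ≤ ⊤))
  have key : ∀ a b : Fin d, pderiv d a (pderiv d b f) x
      = fderiv ℝ (fderiv ℝ f) x (Pi.single a 1) (Pi.single b 1) := by
    intro a b
    unfold pderiv
    rw [fderiv_clm_apply (hd x) (differentiableAt_const _)]
    simp
  rw [key, key]
  exact hs _ _

lemma pdi_smooth {d : ℕ} (k : Fin d) (n : ℕ) {f : (Fin d → ℝ) → ℝ} (hf : ContDiff ℝ (⊤ : ℕ∞) f) :
    ContDiff ℝ (⊤ : ℕ∞) (pderivIter d k n f) := by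
  unfold pderivIter
  induction n with
  | zero => simpa
  | succ n ih => rw [Function.iterate_succ_apply']; exact pd_smooth k ih

lemma pdi_comm {d : ℕ} (k l : Fin d) (n : ℕ) {f : (Fin d → ℝ) → ℝ} (hf : ContDiff ℝ (⊤ : ℕ∞) f) :
    pderivIter d k n (pderiv d l f) = pderiv d l (pderivIter d k n f) := by
  induction n with
  | zero => rfl
  | succ n ih =>
    have h := pdi_smooth k n hf
    unfold pderivIter at *
    rw [Function.iterate_succ_apply', Function.iterate_succ_apply', ih, pd_comm k l h]

/-- fold over a list -/
noncomputable def mfold (d : ℕ) (L : List (Fin d)) (j : Fin d → ℕ) (f : (Fin d → ℝ) → ℝ) :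
    (Fin d → ℝ) → ℝ :=
  L.foldr (fun k g => pderivIter d k (j k) g) f

lemma mfold_cons (d : ℕ) (a) (L : List (Fin d)) (j : Fin d → ℕ) (f : (Fin d → ℝ) → ℝ) :
    mfold d (a :: L) j f = pderivIter d a (j a) (mfold d L j f) := rfl

lemma mfold_smooth {d : ℕ} (L : List (Fin d)) (j : Fin d → ℕ) {f : (Fin d → ℝ) → ℝ}
    (hf : ContDiff ℝ (⊤ : ℕ∞) f) : ContDiff ℝ (⊤ : ℕ∞) (mfold d L j f) := by
  induction L with
  | nil => exact hf
  | cons a L ih => exact pdi_smooth _ _ ih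

lemma mfold_comm {d : ℕ} (L : List (Fin d)) (j : Fin d → ℕ) (l : Fin d) {f : (Fin d → ℝ) → ℝ}
    (hf : ContDiff ℝ (⊤ : ℕ∞) f) : mfold d L j (pderiv d l f) = pderiv d l (mfold d L j f) := by
  induction L with
  | nil => rfl
  | cons a L ih => rw [mfold_cons, mfold_cons, ih, pdi_comm _ _ _ (mfold_smooth L j hf)]

lemma mfold_congr {d : ℕ} (L : List (Fin d)) (j j' : Fin d → ℕ) (f : (Fin d → ℝ) → ℝ)
    (h : ∀ k ∈ L, j k = j' k) : mfold d L j f = mfold d L j' f := by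
  induction L with
  | nil => rfl
  | cons a L ih =>
    rw [mfold_cons, mfold_cons, ih (fun k hk => h k (by simp [hk])), h a (by simp)]

lemma mfold_succ {d : ℕ} (L : List (Fin d)) (hL : L.Nodup) (j : Fin d →₀ ℕ) (l : Fin d)
    (hl : l ∈ L) {f : (Fin d → ℝ) → ℝ} (hf : ContDiff ℝ (⊤ : ℕ∞) f) :
    mfold d L (j + Finsupp.single l 1 : Fin d →₀ ℕ) f = pderiv d l (mfold d L j f) := by
  induction L with
  | nil => simp at hl
  | cons a L ih =>
    rw [List.nodup_cons] at hL
    rw [mfold_cons, mfold_cons]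
    by_cases h : a = l
    · subst h
      rw [mfold_congr L (j + Finsupp.single a 1 : Fin d →₀ ℕ) j]
      · simp only [Finsupp.coe_add, Pi.add_apply, Finsupp.single_eq_same]
        unfold pderivIter
        rw [Function.iterate_succ_apply']
      · intro k hk
        have : a ≠ k := by rintro rfl; exact hL.1 hk
        simp [Finsupp.single_apply, this]
    · have hl' : l ∈ L := by
        rcases List.mem_cons.1 hl with h' | h'
        · exact absurd h'.symm h
        · exact h'
      rw [ih hL.2 hl', pdi_comm _ _ _ (mfold_smooth L j hf)]
      have : l ≠ a := fun h' => h h'.symm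
      simp [Finsupp.single_apply, this]

lemma mixed_succ {d : ℕ} (j : Fin d →₀ ℕ) (l : Fin d)
    {f : (Fin d → ℝ) → ℝ} (hf : ContDiff ℝ (⊤ : ℕ∞) f) :
    mixedPDeriv d (j + Finsupp.single l 1 : Fin d →₀ ℕ) f = pderiv d l (mixedPDeriv d j f) :=
  mfold_succ (List.finRange d) (List.nodup_finRange d) j l (List.mem_finRange l) hf

lemma mixed_comm {d : ℕ} (j : Fin d →₀ ℕ) (l : Fin d)
    {f : (Fin d → ℝ) → ℝ} (hf : ContDiff ℝ (⊤ : ℕ∞) f) :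
    mixedPDeriv d j (pderiv d l f) = pderiv d l (mixedPDeriv d j f) :=
  mfold_comm (List.finRange d) j l hf

lemma mixed_zero {d : ℕ} (f : (Fin d → ℝ) → ℝ) :
    mixedPDeriv d (0 : Fin d →₀ ℕ) f = f := by
  change mfold d (List.finRange d) (0 : Fin d →₀ ℕ) f = f
  induction (List.finRange d) with
  | nil => rfl
  | cons a L ih => rw [mfold_cons, ih]; rfl

lemma mixed_single {d : ℕ} (l : Fin d) (n : ℕ)
    {f : (Fin d → ℝ) → ℝ} (hf : ContDiff ℝ (⊤ : ℕ∞) f) :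
    mixedPDeriv d (Finsupp.single l n : Fin d →₀ ℕ) f = pderivIter d l n f := by
  induction n with
  | zero => rw [Finsupp.single_zero, mixed_zero]; rfl
  | succ n ih =>
    rw [Finsupp.single_add, mixed_succ _ _ hf, ih]
    unfold pderivIter
    rw [Function.iterate_succ_apply']

open Filter Topology in
lemma pdi_germ {d : ℕ} (k : Fin d) (n : ℕ) {f g : (Fin d → ℝ) → ℝ} {x : Fin d → ℝ}
    (h : f =ᶠ[𝓝 x] g) : pderivIter d k n f =ᶠ[𝓝 x] pderivIter d k n g := by
  unfold pderivIter
  induction n with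
  | zero => simpa
  | succ n ih =>
    rw [Function.iterate_succ_apply', Function.iterate_succ_apply']
    filter_upwards [ih.fderiv (𝕜 := ℝ)] with y hy
    unfold pderiv at *
    rw [hy]

open Filter Topology in
lemma mixed_germ {d : ℕ} (j : Fin d → ℕ) {f g : (Fin d → ℝ) → ℝ} {x : Fin d → ℝ}
    (h : f =ᶠ[𝓝 x] g) : mixedPDeriv d j f =ᶠ[𝓝 x] mixedPDeriv d j g := by
  change mfold d (List.finRange d) j f =ᶠ[𝓝 x] mfold d (List.finRange d) j g
  induction (List.finRange d) with
  | nil => exact h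
  | cons a L ih => exact pdi_germ _ _ ih

lemma eval_hasFDeriv {d : ℕ} (p : MvPolynomial (Fin d) ℝ) (v : Fin d → ℝ) :
    ∃ A : (Fin d → ℝ) →L[ℝ] ℝ, HasFDerivAt (fun v => MvPolynomial.eval v p) A v ∧
      ∀ k, A (Pi.single k 1) = MvPolynomial.eval v (MvPolynomial.pderiv k p) := by
  induction p using MvPolynomial.induction_on with
  | C a => exact ⟨0, by simpa using hasFDerivAt_const a v, by simp⟩
  | add p q hp hq =>
    obtain ⟨A, hA, hA'⟩ := hp
    obtain ⟨B, hB, hB'⟩ := hq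
    exact ⟨A + B, by simpa using hA.fun_add hB, fun k => by simp [hA', hB']⟩
  | mul_X p i hp =>
    obtain ⟨A, hA, hA'⟩ := hp
    have := hA.fun_mul (hasFDerivAt_apply (𝕜 := ℝ) i v)
    refine ⟨_, by simpa using this, fun k => ?_⟩
    simp [hA', Pi.single_apply, MvPolynomial.pderiv_X, MvPolynomial.pderiv_mul]
    by_cases h : i = k
    · subst h; simp
    · simp [h]

/-- multi-index factorial -/
def mfac {d : ℕ} (j : Fin d →₀ ℕ) : ℝ := ∏ k, ((j k).factorial : ℝ)

lemma mfac_succ {d : ℕ} (j : Fin d →₀ ℕ) (k : Fin d) :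
    mfac (j + Finsupp.single k 1) = (j k + 1) * mfac j := by
  unfold mfac
  rw [← Finset.mul_prod_erase _ _ (Finset.mem_univ k), ← Finset.mul_prod_erase _ (fun k => ((j k).factorial : ℝ)) (Finset.mem_univ k)]
  rw [Finset.prod_congr rfl (g := fun k => ((j k).factorial : ℝ))]
  · simp [Nat.factorial_succ]; ring
  · intro i hi
    have : k ≠ i := (Finset.ne_of_mem_erase hi).symm
    simp [Finsupp.single_apply, this]

lemma mfac_pos {d : ℕ} (j : Fin d →₀ ℕ) : 0 < mfac j :=
  Finset.prod_pos fun k _ => by positivity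

lemma taylor_bd {d : ℕ} (x₀ : Fin d → ℝ) (M : ℕ) : ∀ (f : (Fin d → ℝ) → ℝ)
    (p : MvPolynomial (Fin d) ℝ), ContDiff ℝ (⊤ : ℕ∞) f →
    (∀ j : Fin d →₀ ℕ, ∑ k, j k < M → p.coeff j * mfac j = mixedPDeriv d j f x₀) →
    ∃ C, 0 ≤ C ∧ ∀ v, ‖v‖ ≤ 1 → |f (x₀ + v) - MvPolynomial.eval v p| ≤ C * ‖v‖ ^ M := by
  induction M with
  | zero =>
    intro f p hf _
    have hc : Continuous fun v => f (x₀ + v) - MvPolynomial.eval v p := by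
      have := hf.continuous
      have := MvPolynomial.continuous_eval p
      fun_prop
    obtain ⟨C, hC⟩ := (isCompact_closedBall (0 : Fin d → ℝ) 1).exists_bound_of_continuousOn
      hc.continuousOn
    refine ⟨max C 0, le_max_right _ _, fun v hv => ?_⟩
    have := hC v (by simpa using hv)
    simpa using Or.inl this
  | succ M ih =>
    intro f p hf hp
    have hk : ∀ k : Fin d, ∃ C, 0 ≤ C ∧ ∀ v, ‖v‖ ≤ 1 →
        |pderiv d k f (x₀ + v) - MvPolynomial.eval v (MvPolynomial.pderiv k p)| ≤ C * ‖v‖ ^ M := by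
      intro k
      refine ih _ _ (pd_smooth k hf) ?_
      intro j hj
      rw [MvPolynomial.coeff_pderiv, mixed_comm _ _ hf, ← mixed_succ _ _ hf, ← hp, mfac_succ]
      · ring
      · simp [Finset.sum_add_distrib, Finsupp.single_apply]; exact hj
    choose C hC0 hC using hk
    refine ⟨∑ k, C k, Finset.sum_nonneg fun k _ => hC0 k, fun v hv => ?_⟩
    have hder : ∀ u, ∃ A : (Fin d → ℝ) →L[ℝ] ℝ,
        HasFDerivAt (fun v => f (x₀ + v) - MvPolynomial.eval v p) A u ∧
        ∀ k, A (Pi.single k 1) = pderiv d k f (x₀ + u)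
          - MvPolynomial.eval u (MvPolynomial.pderiv k p) := by
      intro u
      obtain ⟨A, hA, hA'⟩ := eval_hasFDeriv p u
      have h1 : HasFDerivAt f (fderiv ℝ f (x₀ + u)) (x₀ + u) :=
        ((hf.differentiable (by simp)) _).hasFDerivAt
      have h2 : HasFDerivAt (fun v => f (x₀ + v)) (fderiv ℝ f (x₀ + u)) u := by
        have := h1.comp u ((hasFDerivAt_id u).const_add x₀)
        simpa [Function.comp_def] using this
      exact ⟨_, h2.fun_sub hA, fun k => by simp [hA', pderiv]⟩
    choose A hA hA' using hder
    have hmv := Convex.norm_image_sub_le_of_norm_hasFDerivWithin_le (𝕜 := ℝ)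
      (f := fun v => f (x₀ + v) - MvPolynomial.eval v p) (f' := A)
      (s := Metric.closedBall 0 ‖v‖) (C := (∑ k, C k) * ‖v‖ ^ M) (x := 0) (y := v)
      (fun u _ => (hA u).hasFDerivWithinAt) ?_ (convex_closedBall _ _) (by simp) (by simp)
    · have h0 : f (x₀ + 0) - MvPolynomial.eval 0 p = 0 := by
        have := hp 0 (by simp)
        rw [mixed_zero] at this
        have e : MvPolynomial.eval (0 : Fin d → ℝ) p = p.coeff 0 := by
          rw [← MvPolynomial.constantCoeff_eq, MvPolynomial.eval_zero]
        rw [e, add_zero, ← this]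
        simp [mfac]
      rw [h0, sub_zero, sub_zero, Real.norm_eq_abs] at hmv
      calc _ ≤ _ := hmv
        _ = _ := by ring
    · intro u hu
      have hu' : ‖u‖ ≤ ‖v‖ := by simpa using hu
      refine ContinuousLinearMap.opNorm_le_bound _ (by have := Finset.sum_nonneg fun k (_ : k ∈ Finset.univ) => hC0 k; positivity) ?_
      intro w
      have hw : A u w = ∑ k, w k * A u (Pi.single k 1) := by
        conv_lhs => rw [pi_eq_sum_univ' w]
        simp [map_sum]
      rw [hw, Finset.sum_mul, Finset.sum_mul]
      refine (norm_sum_le _ _).trans (Finset.sum_le_sum fun k _ => ?_)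
      rw [norm_mul, hA', mul_comm, Real.norm_eq_abs]
      have h1 := hC k u (hu'.trans hv)
      have h2 : ‖u‖ ^ M ≤ ‖v‖ ^ M := by gcongr
      have h3 := hC0 k
      have h4 := norm_le_pi_norm w k
      calc _ ≤ (C k * ‖u‖^M) * ‖w k‖ := by gcongr
        _ ≤ _ := by gcongr
/-- weighted curve -/
def cv {d : ℕ} (w : Fin d → ℕ) (c : Fin d → ℝ) (t : ℝ) : Fin d → ℝ := fun k => c k * t ^ w k

/-- restriction of a polynomial to a weighted curve -/
noncomputable def qq {d : ℕ} (w : Fin d → ℕ) (p : MvPolynomial (Fin d) ℝ) (c : Fin d → ℝ) :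
    Polynomial ℝ :=
  ∑ j ∈ p.support, Polynomial.monomial (∑ k, w k * j k) (p.coeff j * ∏ k, c k ^ j k)

lemma qq_eval {d : ℕ} (w : Fin d → ℕ) (p : MvPolynomial (Fin d) ℝ) (c : Fin d → ℝ) (t : ℝ) :
    (qq w p c).eval t = MvPolynomial.eval (cv w c t) p := by
  rw [MvPolynomial.eval_eq', qq, Polynomial.eval_finsetSum]
  refine Finset.sum_congr rfl fun j _ => ?_
  rw [Polynomial.eval_monomial, mul_assoc, ← Finset.prod_pow_eq_pow_sum, ← Finset.prod_mul_distrib]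
  simp [cv, mul_pow, pow_mul]

lemma qq_coeff {d : ℕ} (w : Fin d → ℕ) (p : MvPolynomial (Fin d) ℝ) (c : Fin d → ℝ) (m : ℕ) :
    (qq w p c).coeff m = ∑ j ∈ p.support with ∑ k, w k * j k = m,
      p.coeff j * ∏ k, c k ^ j k := by
  rw [qq, Polynomial.finsetSum_coeff, Finset.sum_filter]
  exact Finset.sum_congr rfl fun j _ => Polynomial.coeff_monomial

open Filter Topology

lemma cv_tendsto {d : ℕ} (w : Fin d → ℕ) (hw : ∀ k, 1 ≤ w k) (c : Fin d → ℝ) :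
    Tendsto (cv w c) (𝓝[>] 0) (𝓝 0) := by
  have hc : Continuous (cv w c) := by unfold cv; fun_prop
  have h0 : cv w c 0 = 0 := by
    funext k; have := hw k; simp [cv]; right; omega
  have := hc.tendsto 0
  rw [h0] at this
  exact this.mono_left nhdsWithin_le_nhds

lemma cv_norm {d : ℕ} (w : Fin d → ℕ) (hw : ∀ k, 1 ≤ w k) (c : Fin d → ℝ) (t : ℝ)
    (h0 : 0 ≤ t) (h1 : t ≤ 1) : ‖cv w c t‖ ≤ ‖c‖ * t := by
  rw [pi_norm_le_iff_of_nonneg (by positivity)]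
  intro k
  have e : t ^ w k ≤ t := pow_le_of_le_one h0 h1 (by have := hw k; omega)
  have := norm_le_pi_norm c k
  simp only [cv, norm_mul]
  rw [Real.norm_of_nonneg (pow_nonneg h0 _)]
  gcongr

lemma approx {d : ℕ} (x₀ : Fin d → ℝ) (N : ℕ) (f : (Fin d → ℝ) → ℝ)
    (p : MvPolynomial (Fin d) ℝ) (hf : ContDiff ℝ (⊤ : ℕ∞) f)
    (hp : ∀ j : Fin d →₀ ℕ, ∑ k, j k < N → p.coeff j * mfac j = mixedPDeriv d j f x₀)
    (w : Fin d → ℕ) (hw : ∀ k, 1 ≤ w k) (c : Fin d → ℝ) :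
    (fun t : ℝ => f (x₀ + cv w c t) - (qq w p c).eval t) =O[𝓝[>] 0] (fun t => t ^ N) := by
  obtain ⟨C, hC0, hC⟩ := taylor_bd x₀ N f p hf hp
  refine Asymptotics.IsBigO.of_bound (C * ‖c‖ ^ N) ?_
  have hs := (cv_tendsto w hw c).eventually (Metric.closedBall_mem_nhds _ one_pos)
  filter_upwards [hs, self_mem_nhdsWithin,
    nhdsWithin_le_nhds (Iic_mem_nhds (zero_lt_one' ℝ))] with t h1 h2 h3
  have h2' : 0 < t := h2
  rw [qq_eval]
  refine (hC _ (by simpa using h1)).trans ?_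
  have := cv_norm w hw c t h2'.le h3
  rw [Real.norm_of_nonneg (by positivity), mul_assoc, ← mul_pow]
  gcongr

lemma flat_iff {d : ℕ} (x₀ : Fin d → ℝ) (N : ℕ) (hN : 0 < N) (f : (Fin d → ℝ) → ℝ)
    (p : MvPolynomial (Fin d) ℝ) (hf : ContDiff ℝ (⊤ : ℕ∞) f)
    (hp : ∀ j : Fin d →₀ ℕ, ∑ k, j k < N → p.coeff j * mfac j = mixedPDeriv d j f x₀)
    (w : Fin d → ℕ) (hw : ∀ k, 1 ≤ w k) (c : Fin d → ℝ) :
    (fun t : ℝ => f (x₀ + cv w c t) - f x₀) =O[𝓝[>] 0] (fun t => t ^ N) ↔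
      ∀ m, 0 < m → m < N → (qq w p c).coeff m = 0 := by
  have ha := approx x₀ N f p hf hp w hw c
  have hz : (qq w p c).coeff 0 = f x₀ := by
    have h1 : cv w c 0 = 0 := by
      funext k; have := hw k; simp [cv]; right; omega
    have h2 := hp 0 (by simpa using hN)
    rw [mixed_zero] at h2
    rw [Polynomial.coeff_zero_eq_eval_zero, qq_eval, h1, ← h2,
      MvPolynomial.eval_zero, MvPolynomial.constantCoeff_eq]
    simp [mfac]
  constructor
  · intro h m hm hmN
    have h1 := aux_uni N (qq w p c - Polynomial.C (f x₀)) ?_ m hmN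
    · simpa [Polynomial.coeff_C, hm.ne'] using h1
    · refine (h.sub ha).congr_left fun t => ?_
      simp
  · intro h
    have hd : Polynomial.X ^ N ∣ qq w p c - Polynomial.C (f x₀) := by
      rw [Polynomial.X_pow_dvd_iff]
      intro m hm
      rcases Nat.eq_zero_or_pos m with rfl | h0
      · simp [hz]
      · simp [Polynomial.coeff_C, h0.ne', h m h0 hm]
    obtain ⟨r, hr⟩ := hd
    have h1 : (fun t : ℝ => (qq w p c - Polynomial.C (f x₀)).eval t) =O[𝓝[>] 0]
        (fun t => t ^ N) := by
      rw [hr]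
      have h2 : (fun t : ℝ => r.eval t) =O[𝓝[>] 0] (fun _ => (1:ℝ)) :=
        ((r.continuous.tendsto 0).mono_left nhdsWithin_le_nhds).isBigO_one ℝ
      have := (Asymptotics.isBigO_refl (fun t : ℝ => t ^ N) (𝓝[>] 0)).mul h2
      simpa using this
    refine (ha.add h1).congr_left fun t => ?_
    simp

lemma support_coeff {d : ℕ} (w : Fin d → ℕ) (p : MvPolynomial (Fin d) ℝ) (N : ℕ)
    (S : Finset (Fin d))
    (h : ∀ j : Fin d →₀ ℕ, j.support ⊆ S → 0 < ∑ k, w k * j k → ∑ k, w k * j k < N →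
      p.coeff j = 0) (c : Fin d → ℝ) (hc : ∀ k, k ∉ S → c k = 0) :
    ∀ m, 0 < m → m < N → (qq w p c).coeff m = 0 := by
  intro m h0 hm
  rw [qq_coeff]
  refine Finset.sum_eq_zero fun j hj => ?_
  have hj' := (Finset.mem_filter.1 hj).2
  by_cases hs : j.support ⊆ S
  · rw [h j hs (by omega) (by omega), zero_mul]
  · obtain ⟨k, hk, hkS⟩ := Finset.not_subset.1 hs
    rw [Finset.prod_eq_zero (Finset.mem_univ k), mul_zero]
    rw [hc k hkS, zero_pow (Finsupp.mem_support_iff.1 hk)]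

lemma coeff_of_orthant {d : ℕ} (w : Fin d → ℕ) (p : MvPolynomial (Fin d) ℝ) (m : ℕ)
    (S : Finset (Fin d)) (s : Fin d → Set ℝ) (hs : ∀ i, (s i).Infinite)
    (h : ∀ c : Fin d → ℝ, (∀ i, i ∉ S → c i = 0) → (∀ i ∈ S, c i ∈ s i) →
      (qq w p c).coeff m = 0) (j : Fin d →₀ ℕ) (hj : j.support ⊆ S)
      (hjm : ∑ k, w k * j k = m) : p.coeff j = 0 := by
  classical
  let R : MvPolynomial (Fin d) ℝ :=
    ∑ j ∈ p.support with (∑ k, w k * j k = m ∧ j.support ⊆ S), MvPolynomial.monomial j (p.coeff j)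
  have hR : R = 0 := by
    refine MvPolynomial.funext_set s hs ?_
    intro c hc
    have := h (fun i => if i ∈ S then c i else 0) (fun i hi => by simp [hi])
      (fun i hi => by simpa [hi] using hc i (Set.mem_univ i))
    rw [qq_coeff] at this
    rw [map_zero, ← this, map_sum, Finset.sum_filter, Finset.sum_filter]
    refine Finset.sum_congr rfl fun i _ => ?_
    by_cases h1 : ∑ k, w k * i k = m
    · by_cases h2 : i.support ⊆ S
      · simp only [h1, h2, and_self, if_true, MvPolynomial.eval_monomial]
        rw [Finsupp.prod_fintype _ _ (by simp)]
        congr 1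
        refine Finset.prod_congr rfl fun k _ => ?_
        by_cases hk : k ∈ S
        · simp [hk]
        · have : i k = 0 := by
            by_contra h3
            exact hk (h2 (Finsupp.mem_support_iff.2 h3))
          simp [this]
      · simp only [h1, h2, and_false, if_true, if_false]
        obtain ⟨k, hk, hkS⟩ := Finset.not_subset.1 h2
        rw [Finset.prod_eq_zero (Finset.mem_univ k), mul_zero]
        simp [hkS, Finsupp.mem_support_iff.1 hk]
    · simp [h1]
  by_contra hne
  have h1 : R.coeff j = p.coeff j := by
    simp only [R, MvPolynomial.coeff_sum, MvPolynomial.coeff_monomial]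
    rw [Finset.sum_ite_eq' , if_pos]
    simp [hjm, hj, hne]
  rw [hR] at h1
  exact hne (by simpa using h1.symm)

lemma main_coeff {d : ℕ} (x₀ : Fin d → ℝ) (N : ℕ) (hN : 0 < N) (f : (Fin d → ℝ) → ℝ)
    (p : MvPolynomial (Fin d) ℝ) (hf : ContDiff ℝ (⊤ : ℕ∞) f)
    (hp : ∀ j : Fin d →₀ ℕ, ∑ k, j k < N → p.coeff j * mfac j = mixedPDeriv d j f x₀)
    (w : Fin d → ℕ) (hw : ∀ k, 1 ≤ w k) (V : Set (Fin d → ℝ)) (hV : V ∈ 𝓝 x₀)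
    (hm : MonotoneOn f V)
    (hpure : ∀ k n, 0 < n → w k * n < N → p.coeff (Finsupp.single k n) = 0)
    (S : Finset (Fin d)) :
    ∀ j : Fin d →₀ ℕ, j.support ⊆ S → 0 < ∑ k, w k * j k → ∑ k, w k * j k < N →
      p.coeff j = 0 := by
  classical
  induction S using Finset.induction_on with
  | empty =>
    intro j hj h0
    have : j = 0 := by simpa using hj
    simp [this] at h0
  | insert a S ha ih =>
    intro j hj h0 h1
    refine coeff_of_orthant w p _ (insert a S) (fun i => if i = a then Set.Ici 0 else Set.Iic 0)
      ?_ ?_ j hj rfl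
    · intro i
      split_ifs
      · exact Set.Ici_infinite _
      · exact Set.Iic_infinite _
    intro c hc0 hcs
    have hca : 0 ≤ c a := by simpa using hcs a (by simp)
    have hcS : ∀ i, i ≠ a → c i ≤ 0 := by
      intro i hi
      by_cases h : i ∈ S
      · simpa [hi] using hcs i (by simp [h])
      · exact (hc0 i (by simp [hi, h])).le
    refine (flat_iff x₀ N hN f p hf hp w hw c).1 ?_ _ h0 h1
    have hlo := (flat_iff x₀ N hN f p hf hp w hw (Function.update c a 0)).2
      (support_coeff w p N S ih _ (by
        intro k hk
        by_cases h : k = a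
        · subst h; simp
        · simp [h, hc0 k (by simp [h, hk])]))
    have hhi := (flat_iff x₀ N hN f p hf hp w hw (Pi.single a (c a))).2
      (support_coeff w p N {a} (by
        intro i hi hi0 hi1
        obtain ⟨n, rfl⟩ := Finsupp.support_subset_singleton'.1 hi
        have e : ∑ k, w k * (Finsupp.single a n) k = w a * n := by
          rw [Finset.sum_eq_single a] <;> simp +contextual [Finsupp.single_apply, eq_comm]
        rw [e] at hi0 hi1
        exact hpure a n (Nat.pos_of_mul_pos_left hi0) hi1) _ (by
        intro k hk
        have : k ≠ a := by simpa using hk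
        simp [this]))
    have hin : ∀ c', ∀ᶠ t in 𝓝[>] (0:ℝ), x₀ + cv w c' t ∈ V := by
      intro c'
      have h2 := (cv_tendsto w hw c').const_add x₀
      rw [add_zero] at h2
      exact h2.eventually hV
    refine Asymptotics.IsBigO.trans ?_ (hlo.norm_left.add hhi.norm_left)
    refine Asymptotics.IsBigO.of_bound 1 ?_
    filter_upwards [hin c, hin (Function.update c a 0), hin (Pi.single a (c a)),
      self_mem_nhdsWithin] with t m1 m2 m3 ht
    have ht' : 0 < t := ht
    have l1 : f (x₀ + cv w (Function.update c a 0) t) ≤ f (x₀ + cv w c t) := by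
      refine hm m2 m1 (add_le_add_right (fun k => ?_) _)
      simp only [cv]
      refine mul_le_mul_of_nonneg_right ?_ (by positivity)
      by_cases h : k = a
      · subst h; simpa
      · simp [h]
    have l2 : f (x₀ + cv w c t) ≤ f (x₀ + cv w (Pi.single a (c a)) t) := by
      refine hm m1 m3 (add_le_add_right (fun k => ?_) _)
      simp only [cv]
      refine mul_le_mul_of_nonneg_right ?_ (by positivity)
      by_cases h : k = a
      · subst h; simp
      · simpa [h] using hcS k h
    have n1 := neg_abs_le (f (x₀ + cv w (Function.update c a 0) t) - f x₀)
    have n2 := le_abs_self (f (x₀ + cv w (Pi.single a (c a)) t) - f x₀)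
    have n3 := abs_nonneg (f (x₀ + cv w (Function.update c a 0) t) - f x₀)
    have n4 := abs_nonneg (f (x₀ + cv w (Pi.single a (c a)) t) - f x₀)
    simp only [Real.norm_eq_abs, one_mul]
    rw [abs_of_nonneg (add_nonneg n3 n4), abs_le]
    constructor <;> linarith

/-- For a C^∞ coordinatewise nondecreasing function whose pure partial derivatives of
orders below `α_k` vanish at `x₀`, every mixed partial derivative of subcritical
anisotropic order (0 < Σ j_k/α_k < 1) vanishes at `x₀`. -/
theorem stmt1 (d : ℕ) (hd : 1 ≤ d) (U : Set (Fin d → ℝ)) (hU : IsOpen U)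
    (x₀ : Fin d → ℝ) (hx₀ : x₀ ∈ U) (f : (Fin d → ℝ) → ℝ)
    (hsmooth : ContDiffOn ℝ (⊤ : ℕ∞) f U) (hmono : MonotoneOn f U)
    (α : Fin d → ℕ) (hα : ∀ k, 1 ≤ α k)
    (hvanish : ∀ k : Fin d, ∀ j : ℕ, 1 ≤ j → j ≤ α k - 1 → pderivIter d k j f x₀ = 0)
    (j : Fin d → ℕ)
    (hj0 : 0 < ∑ k : Fin d, (j k : ℝ) / (α k : ℝ))
    (hj1 : ∑ k : Fin d, (j k : ℝ) / (α k : ℝ) < 1) :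
    mixedPDeriv d j f x₀ = 0 := by
  classical
  -- global smooth extension of the germ
  obtain ⟨g, hg, hfg⟩ : ∃ g : (Fin d → ℝ) → ℝ, ContDiff ℝ (⊤ : ℕ∞) g ∧ f =ᶠ[𝓝 x₀] g := by
    obtain ⟨r, hr, hrU⟩ := Metric.nhds_basis_closedBall.mem_iff.1 (hU.mem_nhds hx₀)
    let b : ContDiffBump x₀ := ⟨r / 2, r, by positivity, by linarith⟩
    refine ⟨fun x => b x * f x, ?_, ?_⟩
    · rw [contDiff_iff_contDiffAt]
      intro x
      by_cases hx : x ∈ U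
      · exact b.contDiffAt.mul (hsmooth.contDiffAt (hU.mem_nhds hx))
      · have hx' : x ∉ tsupport b := by
          rw [b.tsupport_eq]; exact fun h => hx (hrU h)
        have h0 : (fun x => b x * f x) =ᶠ[𝓝 x] fun _ => 0 := by
          filter_upwards [notMem_tsupport_iff_eventuallyEq.1 hx'] with y hy
          simp [hy]
        exact contDiffAt_const.congr_of_eventuallyEq h0
    · filter_upwards [b.eventuallyEq_one] with y hy
      simp [hy]
  obtain ⟨V, hV, hVm⟩ : ∃ V ∈ 𝓝 x₀, MonotoneOn g V := by
    refine ⟨{x | f x = g x} ∩ U, Filter.inter_mem hfg (hU.mem_nhds hx₀), ?_⟩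
    intro x hx y hy hxy
    rw [← hx.1, ← hy.1]
    exact hmono hx.2 hy.2 hxy
  rw [(mixed_germ j hfg).eq_of_nhds]
  have hvan : ∀ k : Fin d, ∀ n : ℕ, 1 ≤ n → n < α k → pderivIter d k n g x₀ = 0 := by
    intro k n h1 h2
    rw [← (pdi_germ k n hfg).eq_of_nhds]
    exact hvanish k n h1 (by omega)
  let N : ℕ := ∏ k, α k
  let w : Fin d → ℕ := fun k => ∏ i ∈ Finset.univ.erase k, α i
  have hN : 0 < N := Finset.prod_pos fun k _ => hα k
  have hw : ∀ k, 1 ≤ w k := fun k => Nat.succ_le_of_lt (Finset.prod_pos fun i _ => hα i)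
  have hwN : ∀ k, w k * α k = N := fun k => Finset.prod_erase_mul _ _ (Finset.mem_univ k)
  let J : Fin d →₀ ℕ := Finsupp.equivFunOnFinite.symm j
  have hJ : (J : Fin d → ℕ) = j := rfl
  have hsum : ((∑ k, w k * J k : ℕ) : ℝ) = N * ∑ k : Fin d, (j k : ℝ) / (α k : ℝ) := by
    push_cast
    rw [Finset.mul_sum]
    refine Finset.sum_congr rfl fun k _ => ?_
    have : (α k : ℝ) ≠ 0 := by have := hα k; positivity
    rw [← hwN k, hJ]
    push_cast
    field_simp
  have hN' : (0:ℝ) < N := by exact_mod_cast hN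
  have s0 : 0 < ∑ k, w k * J k := by
    have : (0:ℝ) < ((∑ k, w k * J k : ℕ) : ℝ) := by rw [hsum]; positivity
    exact_mod_cast this
  have s1 : ∑ k, w k * J k < N := by
    have : ((∑ k, w k * J k : ℕ) : ℝ) < N := by
      rw [hsum]; exact mul_lt_of_lt_one_right hN' hj1
    exact_mod_cast this
  let B : Finset (Fin d →₀ ℕ) := Finset.Iic (Finsupp.equivFunOnFinite.symm fun _ => N)
  let p : MvPolynomial (Fin d) ℝ :=
    ∑ i ∈ B, MvPolynomial.monomial i (mixedPDeriv d i g x₀ / mfac i)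
  have hp : ∀ i : Fin d →₀ ℕ, ∑ k, i k < N → p.coeff i * mfac i = mixedPDeriv d i g x₀ := by
    intro i hi
    have hiB : i ∈ B := by
      rw [Finset.mem_Iic]
      intro k
      have : i k ≤ ∑ k, i k := Finset.single_le_sum (fun _ _ => Nat.zero_le _) (Finset.mem_univ k)
      simp; omega
    simp only [p, MvPolynomial.coeff_sum, MvPolynomial.coeff_monomial]
    rw [Finset.sum_ite_eq', if_pos hiB, div_mul_cancel₀ _ (mfac_pos i).ne']
  have hpure : ∀ k n, 0 < n → w k * n < N → p.coeff (Finsupp.single k n) = 0 := by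
    intro k n hn hwn
    have h1 : n < α k := by
      rw [← hwN k] at hwn
      exact Nat.lt_of_mul_lt_mul_left hwn
    have h2 := hp (Finsupp.single k n) (by
      simp [Finsupp.single_apply]
      exact (Nat.le_mul_of_pos_left n (hw k)).trans_lt hwn)
    rw [mixed_single _ _ hg, hvan k n hn h1] at h2
    exact (mul_eq_zero.1 h2).resolve_right (mfac_pos _).ne'
  have hfin := main_coeff x₀ N hN g p hg hp w hw V hV hVm hpure Finset.univ J
    (Finset.subset_univ _) s0 s1
  have hle : ∑ k, J k < N := lt_of_le_of_lt
    (Finset.sum_le_sum fun k _ => Nat.le_mul_of_pos_left _ (hw k)) s1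
  have := hp J hle
  rw [hfin, zero_mul] at this
  exact this.symm
end

section
/- Let s ≥ 1 and let α_1,…,α_s be positive integers. Define J_* = {𝐣 = (j_1,…,j_s) ∈ ℤ_{≥0}^s : Σ_{k=1}^s j_k/α_k = 1} and J_1 = {𝐣 ∈ J_* : 𝐣 has at least two nonzero coordinates}. Then the following are equivalent: (i) J_1 = ∅; (ii) J_* has exactly s elements; (iii) gcd(α_{k_1}, α_{k_2}) = 1 for all 1 ≤ k_1 < k_2 ≤ s. -/
theorem aux_single (s : ℕ) (α : Fin s → ℕ) (k : Fin s) (c : ℕ) :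
    ∑ i : Fin s, ((Pi.single k c : Fin s → ℕ) i : ℚ) / (α i : ℚ) = (c : ℚ) / α k := by
  rw [Finset.sum_eq_single k]
  · simp
  · intro b _ hb
    simp [Pi.single_eq_of_ne hb]
  · simp

theorem aux_dvd (s : ℕ) (α : Fin s → ℕ) (hα : ∀ k, 1 ≤ α k)
    (hc : ∀ k₁ k₂ : Fin s, k₁ ≠ k₂ → Nat.gcd (α k₁) (α k₂) = 1)
    (j : Fin s → ℕ) (hj : ∑ k : Fin s, (j k : ℚ) / (α k : ℚ) = 1) (k : Fin s) :
    α k ∣ j k := by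
  have h1 : ∑ i, j i * ∏ l ∈ Finset.univ.erase i, α l = ∏ l, α l := by
    have : ((∑ i, j i * ∏ l ∈ Finset.univ.erase i, α l : ℕ) : ℚ) = ((∏ l, α l : ℕ) : ℚ) := by
      push_cast
      rw [← one_mul (∏ l, (α l : ℚ)), ← hj, Finset.sum_mul]
      refine Finset.sum_congr rfl fun i _ => ?_
      rw [← Finset.mul_prod_erase Finset.univ (fun l => (α l : ℚ)) (Finset.mem_univ i)]
      have : (α i : ℚ) ≠ 0 := by have := hα i; positivity
      field_simp
    exact_mod_cast this
  rw [← Finset.add_sum_erase _ _ (Finset.mem_univ k)] at h1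
  have h2 : α k ∣ ∑ i ∈ Finset.univ.erase k, j i * ∏ l ∈ Finset.univ.erase i, α l := by
    refine Finset.dvd_sum fun i hi => Dvd.dvd.mul_left (Finset.dvd_prod_of_mem _ ?_) _
    have := Finset.ne_of_mem_erase hi
    simp [this.symm]
  have h3 : α k ∣ ∏ l, α l := Finset.dvd_prod_of_mem _ (Finset.mem_univ k)
  rw [← h1] at h3
  have h4 := (Nat.dvd_add_left h2).1 h3
  refine Nat.Coprime.dvd_of_dvd_mul_right (Nat.Coprime.prod_right fun l hl => ?_) h4
  exact hc k l (Finset.ne_of_mem_erase hl).symm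

/-- Equivalent characterizations of when the critical multi-index set `J_*` contains no
multi-index with at least two nonzero coordinates. -/
theorem stmt2 (s : ℕ) (hs : 1 ≤ s) (α : Fin s → ℕ) (hα : ∀ k, 1 ≤ α k) :
    let Jstar : Set (Fin s → ℕ) := {j | ∑ k : Fin s, (j k : ℚ) / (α k : ℚ) = 1}
    let J1 : Set (Fin s → ℕ) :=
      {j ∈ Jstar | 2 ≤ (Finset.univ.filter (fun k : Fin s => j k ≠ 0)).card}
    (J1 = ∅ ↔ Jstar.ncard = s) ∧
      (Jstar.ncard = s ↔
        ∀ k₁ k₂ : Fin s, k₁ ≠ k₂ → Nat.gcd (α k₁) (α k₂) = 1) := by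
  intro Jstar J1
  have hpos : ∀ k, (0 : ℚ) < α k := fun k => by exact_mod_cast hα k
  let E : Fin s → (Fin s → ℕ) := fun k => Pi.single k (α k)
  have hEinj : Function.Injective E := by
    intro a b hab
    by_contra hne
    have := congrFun hab a
    simp only [E, Pi.single_eq_same, Pi.single_eq_of_ne hne] at this
    have := hα a
    omega
  have hEsub : Set.range E ⊆ Jstar := by
    rintro _ ⟨k, rfl⟩
    change ∑ i : Fin s, ((Pi.single k (α k) : Fin s → ℕ) i : ℚ) / (α i : ℚ) = 1
    rw [aux_single, div_self (hpos k).ne']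
  have hEcard : (Set.range E).ncard = s := by
    rw [← Set.image_univ, Set.ncard_image_of_injective _ hEinj]
    simp [Set.ncard_univ]
  have hfin : Jstar.Finite := by
    refine (Set.finite_Iic α).subset fun j hj k => ?_
    have hj' : ∑ k : Fin s, (j k : ℚ) / (α k : ℚ) = 1 := hj
    have h : (j k : ℚ) / α k ≤ 1 := by
      rw [← hj']
      exact Finset.single_le_sum (f := fun k => (j k : ℚ) / (α k : ℚ))
        (fun i _ => by positivity) (Finset.mem_univ k)
    rw [div_le_one (hpos k)] at h
    exact_mod_cast h
  have hA : J1 = ∅ ↔ Jstar.ncard = s := by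
    constructor
    · intro h
      have : Jstar = Set.range E := by
        refine Set.Subset.antisymm (fun j hj => ?_) hEsub
        have hj' : ∑ k : Fin s, (j k : ℚ) / (α k : ℚ) = 1 := hj
        have hlt : (Finset.univ.filter (fun k : Fin s => j k ≠ 0)).card ≤ 1 := by
          by_contra hcon
          have : j ∈ J1 := ⟨hj, by omega⟩
          rw [h] at this
          exact this
        have hex : ∃ k, j k ≠ 0 := by
          by_contra hcon
          push Not at hcon
          simp [hcon] at hj'
        obtain ⟨k, hk⟩ := hex
        have hs : j = Pi.single k (j k) := by
          ext i
          by_cases hi : i = k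
          · subst hi; simp
          · rw [Pi.single_eq_of_ne hi]
            by_contra hne
            exact hi (Finset.card_le_one.1 hlt i (by simpa using hne) k (by simpa using hk))
        rw [hs, aux_single, div_eq_one_iff_eq (hpos k).ne'] at hj'
        have hj2 : j k = α k := by exact_mod_cast hj'
        exact ⟨k, by rw [hs, hj2]⟩
      rw [this, hEcard]
    · intro h
      have he : Set.range E = Jstar :=
        Set.eq_of_subset_of_ncard_le hEsub (by rw [hEcard, h]) hfin
      rw [Set.eq_empty_iff_forall_notMem]
      rintro j ⟨hj, h2⟩
      rw [← he] at hj
      obtain ⟨k, rfl⟩ := hj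
      have : (Finset.univ.filter (fun i : Fin s => E k i ≠ 0)) ⊆ {k} := by
        intro i hi
        simp only [Finset.mem_filter, Finset.mem_univ, true_and] at hi
        rw [Finset.mem_singleton]
        by_contra hne
        exact hi (Pi.single_eq_of_ne hne _)
      have := Finset.card_le_card this
      rw [Finset.card_singleton] at this
      omega
  refine ⟨hA, hA.symm.trans ⟨fun h k₁ k₂ hne => ?_, fun hc => ?_⟩⟩
  · by_contra hg
    obtain ⟨a, ha⟩ := Nat.gcd_dvd_left (α k₁) (α k₂)
    obtain ⟨b, hb⟩ := Nat.gcd_dvd_right (α k₁) (α k₂)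
    have hgpos : 0 < Nat.gcd (α k₁) (α k₂) := Nat.gcd_pos_of_pos_left _ (hα k₁)
    generalize Nat.gcd (α k₁) (α k₂) = d at *
    obtain ⟨e, rfl⟩ : ∃ e, d = e + 2 := ⟨d - 2, by omega⟩
    have h1 := hα k₁
    have h2 := hα k₂
    have ha0 : a ≠ 0 := by rintro rfl; omega
    have hb0 : b ≠ 0 := by rintro rfl; omega
    let j : Fin s → ℕ := Pi.single k₁ a + Pi.single k₂ (b * (e + 1))
    have hj1 : j k₁ ≠ 0 := by simp [j, ha0]
    have hj2 : j k₂ ≠ 0 := by simp [j, hb0]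
    have : j ∈ J1 := by
      refine ⟨?_, ?_⟩
      · change ∑ k : Fin s, (j k : ℚ) / (α k : ℚ) = 1
        simp only [j, Pi.add_apply, Nat.cast_add, add_div, Finset.sum_add_distrib, aux_single]
        rw [ha, hb]
        push_cast
        have : (a : ℚ) ≠ 0 := by exact_mod_cast ha0
        have : (b : ℚ) ≠ 0 := by exact_mod_cast hb0
        have : (e : ℚ) + 2 ≠ 0 := by positivity
        field_simp
        ring
      · exact Finset.one_lt_card.2 ⟨k₁, by simpa using hj1, k₂, by simpa using hj2, hne⟩
    rw [h] at this
    exact this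
  · rw [Set.eq_empty_iff_forall_notMem]
    rintro j ⟨hj, h2⟩
    have hj' : ∑ k : Fin s, (j k : ℚ) / (α k : ℚ) = 1 := hj
    have h3 : ((Finset.univ.filter (fun k : Fin s => j k ≠ 0)).card : ℚ) ≤ 1 := by
      rw [← hj', Finset.card_filter]
      push_cast
      refine Finset.sum_le_sum fun k _ => ?_
      split_ifs with hk
      · rw [one_le_div (hpos k)]
        exact_mod_cast Nat.le_of_dvd (Nat.pos_of_ne_zero hk) (aux_dvd s α hα hc j hj' k)
      · positivity
    have h4 : (Finset.univ.filter (fun k : Fin s => j k ≠ 0)).card ≤ 1 := by exact_mod_cast h3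
    omega
end

section
/- For every odd integer m ≥ 3 and all real numbers y₁, y₂, one has m·y₁^{m−1} + (m−1)·y₁^{m−2}·y₂ + y₂^{m−1} ≥ 0. -/
theorem aux_young (x z : ℝ) (hx : 0 ≤ x) (hz : 0 ≤ z) (k : ℕ) :
    0 ≤ z ^ (k + 1) + k * x ^ (k + 1) - (k + 1) * x ^ k * z := by
  induction k with
  | zero => simp
  | succ k ih =>
    have h1 := mul_nonneg hz ih
    have h2 : 0 ≤ ((k : ℝ) + 1) * x ^ k * (z - x) ^ 2 := by positivity
    have h3 := add_nonneg h1 h2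
    push_cast
    refine h3.trans_eq ?_
    ring

/-- For every odd integer `m ≥ 3` and all reals `y₁, y₂`,
`m·y₁^{m−1} + (m−1)·y₁^{m−2}·y₂ + y₂^{m−1} ≥ 0`. -/
theorem stmt3 (m : ℕ) (hm : Odd m) (hm3 : 3 ≤ m) (y₁ y₂ : ℝ) :
    0 ≤ (m : ℝ) * y₁ ^ (m - 1) + ((m : ℝ) - 1) * y₁ ^ (m - 2) * y₂ + y₂ ^ (m - 1) := by
  obtain ⟨k, rfl⟩ : ∃ k, m = k + 2 := ⟨m - 2, by omega⟩
  have he : Even (k + 1) := by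
    obtain ⟨j, hj⟩ := hm
    exact ⟨j, by omega⟩
  have h := aux_young |y₁| |y₂| (abs_nonneg _) (abs_nonneg _) k
  rw [he.pow_abs, he.pow_abs] at h
  have h2 := neg_abs_le (y₁ ^ k * y₂)
  rw [abs_mul, abs_pow] at h2
  have h3 : 0 ≤ y₁ ^ (k + 1) := he.pow_nonneg _
  have h4 := mul_le_mul_of_nonneg_left h2 (by positivity : (0 : ℝ) ≤ (k : ℝ) + 1)
  have e1 : k + 2 - 1 = k + 1 := rfl
  have e2 : k + 2 - 2 = k := rfl
  rw [e1, e2]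
  push_cast
  linarith
end

section
/- Let m₁, m₂, m be positive odd integers with m ≥ 3. Then the polynomial function f : ℝ² → ℝ given by f(t₁,t₂) = t₁^{m₁m} + t₁^{m₁(m−1)}·t₂^{m₂} + t₁^{m₁}·t₂^{m₂(m−1)} + t₂^{m₂m} is coordinatewise nondecreasing on ℝ²: whenever t₁ ≤ t₁' and t₂ ≤ t₂', one has f(t₁,t₂) ≤ f(t₁',t₂'). -/
theorem aux_young_s4 (a b : ℝ) (ha : 0 ≤ a) (hb : 0 ≤ b) (k : ℕ) :
    (k + 1) * (a ^ k * b) ≤ k * a ^ (k + 1) + b ^ (k + 1) := by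
  induction k with
  | zero => simp
  | succ k ih =>
    have h1 := mul_le_mul_of_nonneg_right ih hb
    have h2 : 0 ≤ ((k : ℝ) + 1) * (a ^ k * (a - b) ^ 2) := by positivity
    push_cast
    have e1 : a ^ (k + 1) = a ^ k * a := pow_succ _ _
    have e2 : a ^ (k + 1 + 1) = a ^ k * a * a := by rw [pow_succ, pow_succ]
    have e3 : b ^ (k + 1 + 1) = b ^ (k + 1) * b := pow_succ _ _
    rw [e1] at h1
    rw [e1, e2, e3]
    nlinarith

theorem aux_deriv (x y : ℝ) (k : ℕ) (hk : Even (k + 1)) :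
    0 ≤ (k + 2) * x ^ (k + 1) + (k + 1) * x ^ k * y + y ^ (k + 1) := by
  have h := aux_young_s4 |x| |y| (abs_nonneg _) (abs_nonneg _) k
  rw [hk.pow_abs, hk.pow_abs, ← abs_pow, ← abs_mul] at h
  have h1 := neg_abs_le (x ^ k * y)
  have h2 : 0 ≤ x ^ (k + 1) := hk.pow_nonneg x
  have h3 : 0 ≤ ((k : ℝ) + 1) * (x ^ k * y + |x ^ k * y|) :=
    mul_nonneg (by positivity) (by linarith)
  nlinarith

theorem aux_mono (y : ℝ) (k : ℕ) (hk : Even (k + 1)) :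
    Monotone (fun x : ℝ => x ^ (k + 2) + x ^ (k + 1) * y + x * y ^ (k + 1) + y ^ (k + 2)) := by
  have hd : ∀ x : ℝ, HasDerivAt
      (fun x : ℝ => x ^ (k + 2) + x ^ (k + 1) * y + x * y ^ (k + 1) + y ^ (k + 2))
      ((k + 2) * x ^ (k + 1) + (k + 1) * x ^ k * y + y ^ (k + 1)) x := by
    intro x
    have h := ((((hasDerivAt_pow (k + 2) x).add ((hasDerivAt_pow (k + 1) x).mul_const y)).add
      ((hasDerivAt_id x).mul_const (y ^ (k + 1)))).add_const (y ^ (k + 2)))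
    refine HasDerivAt.congr_deriv h ?_
    rw [show k + 2 - 1 = k + 1 from rfl, show k + 1 - 1 = k from rfl]
    push_cast
    ring
  apply monotone_of_deriv_nonneg (fun x => (hd x).differentiableAt)
  intro x
  rw [(hd x).deriv]
  exact aux_deriv x y k hk

/-- For positive odd integers `m₁, m₂, m` with `m ≥ 3`, the bivariate polynomial
`f(t₁,t₂) = t₁^{m₁m} + t₁^{m₁(m−1)}·t₂^{m₂} + t₁^{m₁}·t₂^{m₂(m−1)} + t₂^{m₂m}`
is coordinatewise nondecreasing on ℝ². -/
theorem stmt4 (m₁ m₂ m : ℕ) (hm₁ : Odd m₁) (hm₂ : Odd m₂) (hm : Odd m)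
    (hm₁pos : 1 ≤ m₁) (hm₂pos : 1 ≤ m₂) (hm3 : 3 ≤ m)
    (t₁ t₂ t₁' t₂' : ℝ) (h₁ : t₁ ≤ t₁') (h₂ : t₂ ≤ t₂') :
    t₁ ^ (m₁ * m) + t₁ ^ (m₁ * (m - 1)) * t₂ ^ m₂ + t₁ ^ m₁ * t₂ ^ (m₂ * (m - 1)) +
        t₂ ^ (m₂ * m) ≤
      t₁' ^ (m₁ * m) + t₁' ^ (m₁ * (m - 1)) * t₂' ^ m₂ + t₁' ^ m₁ * t₂' ^ (m₂ * (m - 1)) +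
        t₂' ^ (m₂ * m) := by
  obtain ⟨k, rfl⟩ : ∃ k, m = k + 2 := ⟨m - 2, by omega⟩
  have hk : Even (k + 1) := by
    rcases hm with ⟨r, hr⟩
    exact ⟨r, by omega⟩
  have hx := hm₁.strictMono_pow (R := ℝ) |>.monotone h₁
  have hy := hm₂.strictMono_pow (R := ℝ) |>.monotone h₂
  have e : k + 2 - 1 = k + 1 := rfl
  simp only [e, pow_mul]
  have a := aux_mono (t₂ ^ m₂) k hk hx
  have b := aux_mono (t₁' ^ m₁) k hk hy
  simp only at a b
  linarith
end

section
/- Let d ≥ 1, let β_1,…,β_d > 0 and a_1,…,a_d ≥ 0 be real numbers satisfying the ordering a_ℓ·β_{ℓ+1} ≥ a_{ℓ+1}·β_ℓ for all 1 ≤ ℓ ≤ d−1 (i.e., a_1/β_1 ≥ ⋯ ≥ a_d/β_d). Define φ(ℓ) = (Σ_{k=ℓ}^d β_k)/(2 + Σ_{k=ℓ}^d a_k) for ℓ ∈ {1,…,d}, and fix κ ∈ {1,…,d}. Then the following are equivalent: (1) φ(ℓ) < φ(κ) for every ℓ ∈ {1,…,d} with ℓ ≠ κ (κ is the unique maximizer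 of φ); (2) for every ℓ ∈ {1,…,d}, a_ℓ·(Σ_{k=ℓ}^d β_k) ≠ β_ℓ·(2 + Σ_{k=ℓ}^d a_k), and κ = min{ℓ ∈ {1,…,d} : a_ℓ·(Σ_{k=ℓ}^d β_k) < β_ℓ·(2 + Σ_{k=ℓ}^d a_k)} (this set is nonempty since it contains ℓ = d). -/
theorem core5 (d : ℕ) (b a B A : ℕ → ℝ)
    (hb : ∀ n < d, 0 < b n) (hBd : B d = 0)
    (hBn : ∀ n, 0 ≤ B n) (hA : ∀ n, 0 < A n)
    (hB : ∀ n < d, B n = b n + B (n+1)) (hAs : ∀ n < d, A n = a n + A (n+1))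
    (ho : ∀ n, n + 1 < d → a (n+1) * b n ≤ a n * b (n+1))
    (κ : ℕ) (hκ : κ < d) :
    (∀ l < d, l ≠ κ → B l / A l < B κ / A κ) ↔
      ((∀ l < d, a l * B l ≠ b l * A l) ∧ a κ * B κ < b κ * A κ ∧
        ∀ l < d, a l * B l < b l * A l → κ ≤ l) := by
  have e1 : ∀ n < d, (B (n+1) / A (n+1) < B n / A n ↔ a n * B n < b n * A n) := by
    intro n hn
    rw [div_lt_div_iff₀ (hA _) (hA _), hB n hn, hAs n hn]
    constructor <;> intro h <;> linarith
  have e2 : ∀ n < d, (B n / A n < B (n+1) / A (n+1) ↔ b n * A n < a n * B n) := by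
    intro n hn
    rw [div_lt_div_iff₀ (hA _) (hA _), hB n hn, hAs n hn]
    constructor <;> intro h <;> linarith
  have key : ∀ n, n + 1 < d → b n * (a (n+1) * B (n+1) - b (n+1) * A (n+1)) ≤
      b (n+1) * (a n * B n - b n * A n) := by
    intro n hn
    have h1 := mul_le_mul_of_nonneg_right (ho n hn) (hBn (n+1))
    rw [hB n (by omega), hAs n (by omega)]
    linarith
  have m1 : ∀ n, n + 1 < d → a n * B n < b n * A n → a (n+1) * B (n+1) < b (n+1) * A (n+1) := by
    intro n hn h
    have := key n hn
    have h1 := hb n (by omega)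
    have h2 := hb (n+1) hn
    by_contra hc
    nlinarith [mul_nonneg h1.le (sub_nonneg.2 (not_lt.1 hc)), mul_pos h2 (sub_pos.2 h)]
  have m2 : ∀ n, n + 1 < d → b (n+1) * A (n+1) < a (n+1) * B (n+1) → b n * A n < a n * B n := by
    intro n hn h
    have := key n hn
    have h1 := hb n (by omega)
    have h2 := hb (n+1) hn
    by_contra hc
    nlinarith [mul_nonneg h2.le (sub_nonneg.2 (not_lt.1 hc)), mul_pos h1 (sub_pos.2 h)]
  have up : ∀ k l, k ≤ l → l < d → a k * B k < b k * A k → a l * B l < b l * A l := by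
    intro k l hkl
    induction l, hkl using Nat.le_induction with
    | base => intro _ h; exact h
    | succ l hl ih => intro hd h; exact m1 l hd (ih (by omega) h)
  have down : ∀ k l, k ≤ l → l < d → b l * A l < a l * B l → b k * A k < a k * B k := by
    intro k l hkl
    induction l, hkl using Nat.le_induction with
    | base => intro _ h; exact h
    | succ l hl ih => intro hd h; exact ih (by omega) (m2 l hd h)
  constructor
  · intro h
    have hk : a κ * B κ < b κ * A κ := by
      rw [← e1 κ hκ]
      by_cases hd : κ + 1 < d
      · exact h _ hd (by omega)
      · have : κ + 1 = d := by omega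
        rw [this, hBd, zero_div]
        apply div_pos _ (hA _)
        rw [hB κ hκ, this, hBd, add_zero]
        exact hb κ hκ
    have hlow : ∀ l < κ, b l * A l < a l * B l := by
      intro l hl
      obtain ⟨m, rfl⟩ : ∃ m, κ = m + 1 := ⟨κ - 1, by omega⟩
      exact down l m (by omega) (by omega) ((e2 m (by omega)).1 (h m (by omega) (by omega)))
    refine ⟨fun l hl => ?_, hk, fun l hl hh => ?_⟩
    · rcases lt_or_ge l κ with h1 | h1
      · exact (hlow l h1).ne'
      · exact (up κ l h1 hl hk).ne
    · by_contra hc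
      exact lt_asymm hh (hlow l (by omega))
  · rintro ⟨hne, hk, hmin⟩ l hl hlk
    have inc : ∀ k, l + 1 ≤ k → k ≤ κ → B l / A l < B k / A k := by
      have st : ∀ n < κ, B n / A n < B (n+1) / A (n+1) := by
        intro n hn
        rw [e2 n (by omega)]
        refine lt_of_le_of_ne (not_lt.1 fun hc => ?_) (hne n (by omega)).symm
        have := hmin n (by omega) hc
        omega
      intro k hkl
      induction k, hkl using Nat.le_induction with
      | base => intro h; exact st l (by omega)
      | succ k hk ih => intro h; exact (ih (by omega)).trans (st k (by omega))
    have dec : ∀ k, κ + 1 ≤ k → k < d → B k / A k < B κ / A κ := by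
      intro k hkl
      induction k, hkl using Nat.le_induction with
      | base => intro h; exact (e1 κ hκ).2 hk
      | succ k hk' ih =>
        intro h
        exact ((e1 k (by omega)).2 (up κ k (by omega) (by omega) hk)).trans (ih (by omega))
    rcases lt_or_gt_of_ne hlk with h | h
    · exact inc κ h le_rfl
    · exact dec l h hl

theorem rec5 (d : ℕ) (f : Fin d → ℝ) (n : ℕ) (hn : n < d) :
    (∑ k ∈ Finset.univ.filter (fun k : Fin d => n ≤ (k : ℕ)), f k) =
      f ⟨n, hn⟩ + ∑ k ∈ Finset.univ.filter (fun k : Fin d => n + 1 ≤ (k : ℕ)), f k := by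
  have : Finset.univ.filter (fun k : Fin d => n ≤ (k : ℕ)) =
      insert ⟨n, hn⟩ (Finset.univ.filter (fun k : Fin d => n + 1 ≤ (k : ℕ))) := by
    ext k
    simp only [Finset.mem_filter, Finset.mem_univ, true_and, Finset.mem_insert, Fin.ext_iff]
    omega
  rw [this, Finset.sum_insert (by simp)]

theorem ici5 (d : ℕ) (l : Fin d) :
    Finset.Ici l = Finset.univ.filter (fun k : Fin d => (l : ℕ) ≤ (k : ℕ)) := by
  ext k
  simp only [Finset.mem_Ici, Finset.mem_filter, Finset.mem_univ, true_and, Fin.le_def]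


/-- Equivalent characterizations of the effective critical index `κ` as the unique
maximizer of `ℓ ↦ (Σ_{k≥ℓ} β_k)/(2 + Σ_{k≥ℓ} a_k)`. -/
theorem stmt5 (d : ℕ) (hd : 1 ≤ d) (β a : Fin d → ℝ)
    (hβ : ∀ k, 0 < β k) (ha : ∀ k, 0 ≤ a k)
    (horder : ∀ ℓ : Fin d, ∀ h : (ℓ : ℕ) + 1 < d,
      a ⟨(ℓ : ℕ) + 1, h⟩ * β ℓ ≤ a ℓ * β ⟨(ℓ : ℕ) + 1, h⟩)
    (κ : Fin d) :
    ((∀ ℓ : Fin d, ℓ ≠ κ →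
        (∑ k ∈ Finset.Ici ℓ, β k) / (2 + ∑ k ∈ Finset.Ici ℓ, a k) <
          (∑ k ∈ Finset.Ici κ, β k) / (2 + ∑ k ∈ Finset.Ici κ, a k)) ↔
      ((∀ ℓ : Fin d,
          a ℓ * (∑ k ∈ Finset.Ici ℓ, β k) ≠ β ℓ * (2 + ∑ k ∈ Finset.Ici ℓ, a k)) ∧
        IsLeast {ℓ : Fin d |
          a ℓ * (∑ k ∈ Finset.Ici ℓ, β k) < β ℓ * (2 + ∑ k ∈ Finset.Ici ℓ, a k)} κ)) := by
  have H := core5 d (fun n => if h : n < d then β ⟨n, h⟩ else 0)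
    (fun n => if h : n < d then a ⟨n, h⟩ else 0)
    (fun n => ∑ k ∈ Finset.univ.filter (fun k : Fin d => n ≤ (k : ℕ)), β k)
    (fun n => 2 + ∑ k ∈ Finset.univ.filter (fun k : Fin d => n ≤ (k : ℕ)), a k)
    (fun n hn => by simp only [hn, dite_true]; exact hβ _)
    (by
      apply Finset.sum_eq_zero
      intro k hk
      have := k.2
      simp only [Finset.mem_filter] at hk
      omega)
    (fun n => Finset.sum_nonneg fun k _ => (hβ k).le)
    (fun n => add_pos_of_pos_of_nonneg two_pos (Finset.sum_nonneg fun k _ => ha k))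
    (fun n hn => by simp only [hn, dite_true]; exact rec5 d β n hn)
    (fun n hn => by simp only [hn, dite_true]; rw [rec5 d a n hn]; ring)
    (fun n hn => by
      have hn' : n < d := by omega
      simp only [hn, hn', dite_true]; exact horder ⟨n, hn'⟩ hn)
    κ κ.2
  simp only [ici5]
  have hk : ∀ l : Fin d, (if h : (l : ℕ) < d then β ⟨l, h⟩ else 0) = β l := fun l => by simp
  have hk' : ∀ l : Fin d, (if h : (l : ℕ) < d then a ⟨l, h⟩ else 0) = a l := fun l => by simp
  constructor
  · intro h
    obtain ⟨h1, h2, h3⟩ := H.1 (fun l hl hne => h ⟨l, hl⟩ (fun e => hne (congrArg Fin.val e)))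
    refine ⟨fun l => ?_, ?_, fun l hl => ?_⟩
    · have := h1 l l.2
      simpa only [hk, hk'] using this
    · simp only [hk, hk'] at h2
      exact h2
    · have := h3 l l.2
      simp only [hk, hk'] at this
      exact this hl
  · rintro ⟨h1, h2, h3⟩ l hl
    refine H.2 ⟨fun l hl => ?_, ?_, fun l hl h => ?_⟩ l l.2 (fun e => hl (Fin.ext e))
    · simp only [hl, dite_true]; exact h1 ⟨l, hl⟩
    · simp only [hk, hk']; exact h2
    · simp only [hl, dite_true] at h
      exact h3 (a := ⟨l, hl⟩) h
end

section
/- Let (Ω, P) and (Ω', P') be probability spaces. For n ∈ ℕ and real c > 0, let W_{n,c}, W_n : Ω → ℝ and W_c, W : Ω' → ℝ be random variables. Assume: (1) lim_{c→∞} limsup_{n→∞} P(W_{n,c} ≠ W_n) = 0; (2) for every c > 0, W_{n,c} converges in distribution to W_c as n → ∞; (3) lim_{c→∞} P'(W_c ≠ W) = 0. Then W_n converges in distribution to W as n → ∞. -/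
open MeasureTheory Filter

/-- Convergence in distribution of real random variables: expectations of every bounded
continuous test function converge. -/
def ConvInDist {Ω Ω' : Type*} [MeasurableSpace Ω] [MeasurableSpace Ω']
    (P : Measure Ω) (P' : Measure Ω') (Z : ℕ → Ω → ℝ) (Z' : Ω' → ℝ) : Prop :=
  ∀ g : ℝ → ℝ, Continuous g → (∃ M : ℝ, ∀ x, |g x| ≤ M) →
    Tendsto (fun n => ∫ ω, g (Z n ω) ∂P) atTop (nhds (∫ ω, g (Z' ω) ∂P'))

theorem integral_diff_le_aux {Ω : Type*} [MeasurableSpace Ω] (P : Measure Ω)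
    [IsProbabilityMeasure P] (X Y : Ω → ℝ) (hX : Measurable X) (hY : Measurable Y)
    (g : ℝ → ℝ) (hg : Continuous g) (M δ : ℝ) (hM : ∀ x, |g x| ≤ M) (hδ : 0 < δ)
    (h : P {ω | X ω ≠ Y ω} < ENNReal.ofReal δ) :
    |∫ ω, g (X ω) ∂P - ∫ ω, g (Y ω) ∂P| ≤ 2 * M * δ := by
  have hM0 : 0 ≤ M := (abs_nonneg _).trans (hM 0)
  have hi : ∀ Z : Ω → ℝ, Measurable Z → Integrable (fun ω => g (Z ω)) P := fun Z hZ =>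
    Integrable.of_bound (hg.measurable.comp hZ).aestronglyMeasurable M
      (Eventually.of_forall fun ω => hM _)
  have hS : MeasurableSet {ω | X ω ≠ Y ω} := (measurableSet_eq_fun hX hY).compl
  have hreal : P.real {ω | X ω ≠ Y ω} ≤ δ := by
    rw [Measure.real]
    exact ENNReal.toReal_le_of_le_ofReal hδ.le h.le
  rw [← integral_sub (hi X hX) (hi Y hY)]
  calc |∫ ω, (g (X ω) - g (Y ω)) ∂P| ≤ ∫ ω, |g (X ω) - g (Y ω)| ∂P :=
        abs_integral_le_integral_abs
    _ ≤ ∫ ω, {ω | X ω ≠ Y ω}.indicator (fun _ => 2 * M) ω ∂P := by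
        refine integral_mono ((hi X hX).sub (hi Y hY)).abs
          ((integrable_const (2 * M)).indicator hS) fun ω => ?_
        by_cases hω : X ω = Y ω
        · simp [hω]
        · have h1 := abs_le.1 (hM (X ω))
          have h2 := abs_le.1 (hM (Y ω))
          simp only [Set.indicator, Set.mem_setOf_eq, ne_eq, hω, not_false_eq_true, if_true]
          rw [abs_le]
          constructor <;> linarith
    _ = P.real {ω | X ω ≠ Y ω} * (2 * M) := by
        rw [integral_indicator_const _ hS, smul_eq_mul]
    _ ≤ 2 * M * δ := by
        rw [mul_comm]
        gcongr

/-- The localization–delocalization principle (Prakasa Rao): if `W_{n,c}` and `W_n` agree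
with probability tending to one (as `n → ∞` then `c → ∞`), `W_{n,c} ⇝ W_c` for each `c`,
and `W_c` agrees with `W` with probability tending to one as `c → ∞`, then `W_n ⇝ W`. -/
theorem stmt6 {Ω Ω' : Type*} [MeasurableSpace Ω] [MeasurableSpace Ω']
    (P : Measure Ω) (P' : Measure Ω')
    [IsProbabilityMeasure P] [IsProbabilityMeasure P']
    (Wnc : ℕ → ℝ → Ω → ℝ) (Wn : ℕ → Ω → ℝ) (Wc : ℝ → Ω' → ℝ) (W : Ω' → ℝ)
    (hWncMeas : ∀ n c, Measurable (Wnc n c)) (hWnMeas : ∀ n, Measurable (Wn n))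
    (hWcMeas : ∀ c, Measurable (Wc c)) (hWMeas : Measurable W)
    (h1 : Tendsto (fun c : ℝ =>
        limsup (fun n : ℕ => P {ω | Wnc n c ω ≠ Wn n ω}) atTop) atTop (nhds 0))
    (h2 : ∀ c : ℝ, 0 < c → ConvInDist P P' (fun n => Wnc n c) (Wc c))
    (h3 : Tendsto (fun c : ℝ => P' {ω | Wc c ω ≠ W ω}) atTop (nhds 0)) :
    ConvInDist P P' Wn W := by
  rintro g hg ⟨M, hM⟩
  have hM0 : 0 ≤ M := (abs_nonneg _).trans (hM 0)
  rw [Metric.tendsto_atTop']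
  intro ε hε
  have hδ : 0 < ε / (8 * (M + 1)) := by positivity
  have hMδ : 2 * M * (ε / (8 * (M + 1))) ≤ ε / 4 := by
    rw [← mul_div_assoc, div_le_div_iff₀ (by positivity) (by positivity)]
    nlinarith
  generalize ε / (8 * (M + 1)) = δ at hδ hMδ
  have hδ' : (0 : ENNReal) < ENNReal.ofReal δ := ENNReal.ofReal_pos.2 hδ
  obtain ⟨c, hc1, hc3, hc0⟩ := ((h1.eventually_lt_const hδ').and
    ((h3.eventually_lt_const hδ').and (eventually_gt_atTop 0))).exists
  have e1 := eventually_lt_of_limsup_lt hc1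
  have e2 := (Metric.tendsto_nhds.1 (h2 c hc0 g hg ⟨M, hM⟩)) (ε / 4) (by positivity)
  obtain ⟨N, hN⟩ := eventually_atTop.1 (e1.and e2)
  refine ⟨N, fun n hn => ?_⟩
  obtain ⟨a1, a2⟩ := hN n hn.le
  have b1 := integral_diff_le_aux P _ _ (hWncMeas n c) (hWnMeas n) g hg M δ hM hδ a1
  have b3 := integral_diff_le_aux P' _ _ (hWcMeas c) hWMeas g hg M δ hM hδ hc3
  rw [Real.dist_eq] at a2 ⊢
  rw [abs_lt] at a2 ⊢
  rw [abs_le] at b1 b3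
  constructor <;> linarith [a2.1, a2.2, b1.1, b1.2, b3.1, b3.2]
end

section
/- Let n ≥ 1, d ≥ 1, σ > 0, α ≥ 0, γ ≥ 0, let x₀ ∈ [0,1]^d, let X_1,…,X_n ∈ [0,1]^d be fixed design points, and let f₀, f₁ : [0,1]^d → ℝ be measurable functions with Σ_{i=1}^n (f₁(X_i) − f₀(X_i))² ≤ α and |f₁(x₀) − f₀(x₀)| ≥ γ. For f ∈ {f₀, f₁}, let P_f be the product probability measure on ℝⁿ whose i-th factor is the Gaussian distribution N(f(X_i), σ²). Then for every measurable T : ℝⁿ → ℝ, max_{f ∈ {f₀,f₁}} ∫_{ℝⁿ} |T(y) − f(x₀)| dP_f(y) ≥ (γ/8)·exp(−α/(2σ²)). -/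
open MeasureTheory ProbabilityTheory

lemma aux_meas {n : ℕ} (m : Fin n → ℝ) (v : NNReal) :
    Measurable (fun y : Fin n → ℝ => ENNReal.ofReal (∏ i, gaussianPDFReal (m i) v (y i))) := by
  refine ENNReal.measurable_ofReal.comp ?_
  refine Finset.measurable_prod _ fun i _ => ?_
  exact (measurable_gaussianPDFReal _ _).comp (measurable_pi_apply i)

lemma aux_density {n : ℕ} (m : Fin n → ℝ) (v : NNReal) (hv : v ≠ 0) :
    (Measure.pi fun i : Fin n => gaussianReal (m i) v) =
      (volume : Measure (Fin n → ℝ)).withDensity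
        (fun y => ENNReal.ofReal (∏ i, gaussianPDFReal (m i) v (y i))) := by
  refine Measure.pi_eq fun s hs => ?_
  have hint : Integrable (fun y : Fin n → ℝ => ∏ i, gaussianPDFReal (m i) v (y i))
      (Measure.pi fun i => (volume : Measure ℝ).restrict (s i)) := by
    refine Integrable.fintype_prod_dep fun i => ?_
    exact (integrable_gaussianPDFReal (m i) v).restrict
  rw [withDensity_apply _ (MeasurableSet.univ_pi hs), volume_pi, Measure.restrict_pi_pi,
    ← ofReal_integral_eq_lintegral_ofReal hint
      (Filter.Eventually.of_forall fun y => Finset.prod_nonneg fun i _ =>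
        gaussianPDFReal_nonneg _ _ _),
    integral_fintype_prod_eq_prod (𝕜 := ℝ) (fun i x => gaussianPDFReal (m i) v x),
    ENNReal.ofReal_prod_of_nonneg]
  · refine Finset.prod_congr rfl fun i _ => ?_
    rw [gaussianReal_apply_eq_integral _ hv]
  · intro i _
    exact integral_nonneg fun x => gaussianPDFReal_nonneg _ _ _

lemma aux_pdf (a b x : ℝ) (v : NNReal) :
    gaussianPDFReal a v x * gaussianPDFReal b v x =
      Real.exp (-(b - a) ^ 2 / (4 * v)) * gaussianPDFReal ((a + b) / 2) v x ^ 2 := by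
  simp only [gaussianPDFReal]
  rw [mul_pow, ← Real.exp_nat_mul]
  have : Real.exp (-(x - a) ^ 2 / (2 * v)) * Real.exp (-(x - b) ^ 2 / (2 * v)) =
      Real.exp (-(b - a) ^ 2 / (4 * v)) * Real.exp ((2 : ℕ) * (-(x - (a + b) / 2) ^ 2 / (2 * v))) := by
    rw [← Real.exp_add, ← Real.exp_add]
    congr 1
    by_cases hv : (v : ℝ) = 0
    · simp [hv]
    · field_simp
      push_cast
      ring
  linear_combination (√(2 * Real.pi * v))⁻¹ ^ 2 * this

lemma aux_half (p q g c : ℝ) (hp : 0 ≤ p) (hq : 0 ≤ q) (hpq : p * q = c * g ^ 2)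
    (hc : 0 ≤ c) :
    c * g ≤ p + c / 4 * q := by
  refine abs_le_of_sq_le_sq' ?_ (by positivity) |>.2
  nlinarith [sq_nonneg (p - c / 4 * q)]

lemma aux_ineq (p q g c a b γ : ℝ) (hp : 0 ≤ p) (hq : 0 ≤ q) (hc : 0 ≤ c) (hc1 : c ≤ 1)
    (hpq : p * q = c * g ^ 2) (ha : 0 ≤ a) (hb : 0 ≤ b) (hγ : 0 ≤ γ) (hab : γ ≤ a + b) :
    γ * c * g ≤ p * a + q * b + γ * c / 4 * (p + q) := by
  have h0 : 0 ≤ γ * (c / 4 * p) := by positivity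
  have h1 : 0 ≤ γ * (c / 4 * q) := by positivity
  rcases le_total p q with h | h
  · have := mul_le_mul_of_nonneg_left (aux_half p q g c hp hq hpq hc) hγ
    nlinarith [mul_le_mul_of_nonneg_right h hb, mul_le_mul_of_nonneg_left hab hp]
  · have := mul_le_mul_of_nonneg_left
      (aux_half q p g c hq hp (by rw [mul_comm]; exact hpq) hc) hγ
    nlinarith [mul_le_mul_of_nonneg_right h ha, mul_le_mul_of_nonneg_left hab hq]

lemma aux_main {n : ℕ} (a b : Fin n → ℝ) (v : NNReal) (hv : v ≠ 0) (θ₀ θ₁ γ c : ℝ) (hγ : 0 ≤ γ)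
    (hsep : γ ≤ |θ₁ - θ₀|) (hc : c = Real.exp (-(∑ i, (b i - a i) ^ 2) / (4 * v)))
    (T : (Fin n → ℝ) → ℝ) (hT : Measurable T) :
    ENNReal.ofReal (γ * c / 2) ≤
      (∫⁻ y, ENNReal.ofReal |T y - θ₀| ∂(Measure.pi fun i => gaussianReal (a i) v)) +
      (∫⁻ y, ENNReal.ofReal |T y - θ₁| ∂(Measure.pi fun i => gaussianReal (b i) v)) := by
  have hc0 : 0 ≤ c := hc ▸ (Real.exp_pos _).le
  have hc1 : c ≤ 1 := by
    rw [hc, Real.exp_le_one_iff, neg_div]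
    have : 0 ≤ ∑ i, (b i - a i) ^ 2 := Finset.sum_nonneg fun i _ => sq_nonneg _
    have : 0 ≤ (∑ i, (b i - a i) ^ 2) / (4 * (v : ℝ)) := by positivity
    linarith
  let D : (Fin n → ℝ) → (Fin n → ℝ) → ℝ := fun m y => ∏ i, gaussianPDFReal (m i) v (y i)
  have hD0 : ∀ m y, 0 ≤ D m y := fun m y =>
    Finset.prod_nonneg fun i _ => gaussianPDFReal_nonneg _ _ _
  have hDm : ∀ m, Measurable fun y => ENNReal.ofReal (D m y) := fun m => aux_meas m v
  have hD1 : ∀ m, ∫⁻ y, ENNReal.ofReal (D m y) = 1 := by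
    intro m
    have h := aux_density m v hv
    have h2 : (Measure.pi fun i : Fin n => gaussianReal (m i) v) Set.univ = 1 := measure_univ
    rw [h, withDensity_apply _ MeasurableSet.univ, Measure.restrict_univ] at h2
    exact h2
  let g : Fin n → ℝ := fun i => (a i + b i) / 2
  have hDD : ∀ y, D a y * D b y = c * D g y ^ 2 := by
    intro y
    simp only [D, g]
    rw [← Finset.prod_mul_distrib, ← Finset.prod_pow, hc, ← Finset.sum_neg_distrib,
      Finset.sum_div, Real.exp_sum, ← Finset.prod_mul_distrib]
    exact Finset.prod_congr rfl fun i _ => aux_pdf _ _ _ _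
  have hm : ∀ θ, Measurable fun y => ENNReal.ofReal |T y - θ| := fun θ => by fun_prop
  rw [aux_density a v hv, aux_density b v hv,
    lintegral_withDensity_eq_lintegral_mul _ (hDm a) (hm θ₀),
    lintegral_withDensity_eq_lintegral_mul _ (hDm b) (hm θ₁),
    ← lintegral_add_left ((hDm a).mul (hm θ₀))]
  change _ ≤ ∫⁻ y, (ENNReal.ofReal (D a y) * ENNReal.ofReal |T y - θ₀|
            + ENNReal.ofReal (D b y) * ENNReal.ofReal |T y - θ₁|)
  set R := ∫⁻ y, (ENNReal.ofReal (D a y) * ENNReal.ofReal |T y - θ₀|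
            + ENNReal.ofReal (D b y) * ENNReal.ofReal |T y - θ₁|) with hR
  have key : ENNReal.ofReal (γ * c) ≤ R + ENNReal.ofReal (γ * c / 2) := by
    calc ENNReal.ofReal (γ * c)
        = ∫⁻ y, ENNReal.ofReal (γ * c) * ENNReal.ofReal (D g y) := by
          rw [lintegral_const_mul _ (hDm g), hD1, mul_one]
      _ ≤ ∫⁻ y, ((ENNReal.ofReal (D a y) * ENNReal.ofReal |T y - θ₀|
            + ENNReal.ofReal (D b y) * ENNReal.ofReal |T y - θ₁|)
            + ENNReal.ofReal (γ * c / 4) * (ENNReal.ofReal (D a y) + ENNReal.ofReal (D b y))) := by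
          refine lintegral_mono fun y => ?_
          have ha := hD0 a y
          have hb := hD0 b y
          dsimp only
          rw [← ENNReal.ofReal_mul (by positivity), ← ENNReal.ofReal_mul ha,
            ← ENNReal.ofReal_mul hb, ← ENNReal.ofReal_add ha hb,
            ← ENNReal.ofReal_mul (by positivity), ← ENNReal.ofReal_add (by positivity)
            (by positivity), ← ENNReal.ofReal_add (by positivity) (by positivity)]
          refine ENNReal.ofReal_le_ofReal ?_
          refine aux_ineq _ _ _ c _ _ γ ha hb hc0 hc1 (hDD y) (abs_nonneg _) (abs_nonneg _) hγ ?_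
          refine hsep.trans ?_
          have := abs_sub (T y - θ₀) (T y - θ₁)
          rwa [show T y - θ₀ - (T y - θ₁) = θ₁ - θ₀ by ring] at this
      _ = R + ENNReal.ofReal (γ * c / 2) := by
          have hs : Measurable fun y => ENNReal.ofReal (D a y) + ENNReal.ofReal (D b y) :=
            (hDm a).add (hDm b)
          rw [lintegral_add_right _ (hs.const_mul _), lintegral_const_mul _ hs, lintegral_add_left (hDm a), hD1, hD1]
          congr 1
          rw [show (1 : ENNReal) + 1 = ENNReal.ofReal 2 by norm_num,
            ← ENNReal.ofReal_mul (by positivity)]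
          congr 1
          ring
  have h2 : ENNReal.ofReal (γ * c) = ENNReal.ofReal (γ * c / 2) + ENNReal.ofReal (γ * c / 2) := by
    rw [← ENNReal.ofReal_add (by positivity) (by positivity)]
    congr 1
    ring
  rw [h2] at key
  exact (ENNReal.add_le_add_iff_right ENNReal.ofReal_ne_top).1 key


/-- Two-point minimax lower bound for estimating `f(x₀)` in Gaussian regression with
fixed design points: for any estimator `T`, the maximum risk over `{f₀, f₁}` is at least
`(γ/8)·exp(−α/(2σ²))` whenever `Σᵢ (f₁(Xᵢ) − f₀(Xᵢ))² ≤ α` and `|f₁(x₀) − f₀(x₀)| ≥ γ`. -/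
theorem stmt7 (n d : ℕ) (hn : 1 ≤ n) (hd : 1 ≤ d) (σ α γ : ℝ)
    (hσ : 0 < σ) (hα : 0 ≤ α) (hγ : 0 ≤ γ)
    (x₀ : Fin d → ℝ) (hx₀ : x₀ ∈ Set.Icc (0 : Fin d → ℝ) 1)
    (X : Fin n → (Fin d → ℝ)) (hX : ∀ i, X i ∈ Set.Icc (0 : Fin d → ℝ) 1)
    (f₀ f₁ : (Fin d → ℝ) → ℝ) (hf₀ : Measurable f₀) (hf₁ : Measurable f₁)
    (hclose : ∑ i : Fin n, (f₁ (X i) - f₀ (X i)) ^ 2 ≤ α)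
    (hsep : γ ≤ |f₁ x₀ - f₀ x₀|)
    (T : (Fin n → ℝ) → ℝ) (hT : Measurable T) :
    ENNReal.ofReal ((γ / 8) * Real.exp (-α / (2 * σ ^ 2))) ≤
      max
        (∫⁻ y, ENNReal.ofReal |T y - f₀ x₀|
          ∂(Measure.pi fun i : Fin n => gaussianReal (f₀ (X i)) ((σ ^ 2).toNNReal)))
        (∫⁻ y, ENNReal.ofReal |T y - f₁ x₀|
          ∂(Measure.pi fun i : Fin n => gaussianReal (f₁ (X i)) ((σ ^ 2).toNNReal))) := by
  have hv : (σ ^ 2).toNNReal ≠ 0 := by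
    have : 0 < σ ^ 2 := by positivity
    simpa using this.ne'
  have h := aux_main (fun i => f₀ (X i)) (fun i => f₁ (X i)) _ hv (f₀ x₀) (f₁ x₀) γ _ hγ hsep rfl
    T hT
  rw [Real.coe_toNNReal _ (sq_nonneg σ)] at h
  by_contra hlt
  rw [not_le, max_lt_iff] at hlt
  have h3 := h.trans_lt (ENNReal.add_lt_add hlt.1 hlt.2)
  rw [← ENNReal.ofReal_add (by positivity) (by positivity)] at h3
  refine absurd h3 (not_lt.2 (ENNReal.ofReal_le_ofReal ?_))
  have h4 : Real.exp (-α / (2 * σ ^ 2)) ≤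
      Real.exp (-(∑ i, (f₁ (X i) - f₀ (X i)) ^ 2) / (4 * σ ^ 2)) := by
    refine Real.exp_le_exp.2 ?_
    rw [div_le_div_iff₀ (by positivity) (by positivity)]
    have : 0 < σ ^ 2 := by positivity
    nlinarith [mul_le_mul_of_nonneg_right hclose this.le, mul_nonneg hα this.le]
  nlinarith [mul_le_mul_of_nonneg_left h4 hγ,
    mul_nonneg hγ (Real.exp_pos (-α / (2 * σ ^ 2))).le]
end
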